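/- arXiv:2108.03641 — 3 statements merged into one kernel-verified Lean document; each statement's English description precedes it below -/
import Mathlib

section
/- For every extended BC protocol there exists a BC protocol that is strongly envy-equivalent to it. -/
/-! ## Cake, valuations, envy, abstract game forms -/

/-- A piece of cake: a finite list of subintervals of `[0,1]`, given by endpoint pairs. -/
abbrev Piece := List (ℝ × ℝ)

/-- A valuation function on subintervals of `[0,1]`: nonnegative, normalized,
additive and divisible. -/
structure CakeValuation where
  v : ℝ → ℝ → ℝ
  nonneg : ∀ a b, 0 ≤ a → a ≤ b → b ≤ 1 → 0 ≤ v a b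
  normalized : v 0 1 = 1
  additive : ∀ a b c, 0 ≤ a → a ≤ b → b ≤ c → c ≤ 1 → v a b + v b c = v a c
  divisible : ∀ a b, 0 ≤ a → a ≤ b → b ≤ 1 → ∀ lam : ℝ, 0 ≤ lam → lam ≤ 1 →
    ∃ c, a ≤ c ∧ c ≤ b ∧ v a c = lam * v a b

/-- The value of a piece of cake: the sum of the values of its intervals. -/
def pieceValue (V : CakeValuation) (P : Piece) : ℝ := (P.map fun q => V.v q.1 q.2).sum

/-- The envy of agent `i` towards agent `j` under allocation `A`. -/
def envy {n : ℕ} (V : CakeValuation) (A : Fin n → Piece) (i j : Fin n) : ℝ :=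
  max (pieceValue V (A j) - pieceValue V (A i)) 0

/-- An abstract cake-cutting protocol, viewed as an extensive-form game:
each agent has a type of strategies, and a strategy profile determines the
final allocation of pieces of cake to the agents. -/
structure GameForm (n : ℕ) where
  Strategy : Fin n → Type
  play : (∀ i, Strategy i) → Fin n → Piece

/-- Agent `i`, with private valuation `V`, can guarantee the envy bounds
`envy (i, j) ≤ M j` for all `j ∈ S` in protocol `P`: `i` has a strategy such that
against all strategies of the other agents the bounds hold. -/
def Guarantees {n : ℕ} (P : GameForm n) (i : Fin n) (S : Finset (Fin n))
    (M : Fin n → ℝ) (V : CakeValuation) : Prop :=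
  ∃ s : P.Strategy i, ∀ σ : ∀ j, P.Strategy j, σ i = s →
    ∀ j ∈ S, envy V (P.play σ) i j ≤ M j

/-- Two protocols are strongly envy-equivalent if every agent can guarantee the same
simultaneous envy bounds (with values in `[0,1]`, against any set `S` of other agents)
in both. -/
def StronglyEnvyEquiv {n : ℕ} (P P' : GameForm n) : Prop :=
  ∀ (i : Fin n) (S : Finset (Fin n)), i ∉ S →
    ∀ M : Fin n → ℝ, (∀ j ∈ S, M j ∈ Set.Icc (0 : ℝ) 1) →
      ∀ V : CakeValuation, (Guarantees P i S M V ↔ Guarantees P' i S M V)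

/-! ## Histories and strategies -/

/-- An execution history: the sequence of cut points made (`Sum.inl`)
and of discrete choices taken (`Sum.inr`) so far. -/
abbrev Hist := List (ℝ ⊕ ℕ)

/-- A strategy of an agent: as a function of the execution history, where to cut
at a node where the agent cuts, and which index to pick at a node where the agent
chooses. -/
structure BCStrategy where
  cutAt : Hist → ℝ
  chooseAt : Hist → ℕ

/-- The initial reference points of the cake `[0,1]`. -/
def initPts : Fin 2 → ℝ := fun t => if t = 0 then 0 else 1

/-- Turn a list of (interval, agent) pairs into an allocation. -/
def allocOf {n : ℕ} (L : List (ℝ × ℝ × Fin n)) : Fin n → Piece :=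
  fun a => (L.filter fun q => decide (q.2.2 = a)).map fun q => (q.1, q.2.1)

/-! ## Branch choice (BC) protocols -/

/-- A branch choice (BC) protocol tree over `n` agents, indexed by the number of cuts
made so far.  At a `cut` node, the designated agent makes one cut inside the `j`-th
contiguous piece of the current partition of the cake (such a node has one child);
at a `choose` node the designated agent selects which child the execution proceeds to;
a `leaf` assigns each contiguous piece of the final partition to an agent. -/
inductive BCTree (n : ℕ) : ℕ → Type
  | leaf {m : ℕ} (alloc : Fin (m + 1) → Fin n) : BCTree n m
  | cut {m : ℕ} (agent : Fin n) (piece : Fin (m + 1)) (child : BCTree n (m + 1)) : BCTree n m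
  | choose {m : ℕ} (agent : Fin n) {k : ℕ} (children : Fin (k + 1) → BCTree n m) : BCTree n m

/-- Insert a new cut point `y` inside the `j`-th piece of the sorted partition `c`. -/
def insertPt {m : ℕ} (c : Fin (m + 2) → ℝ) (j : Fin (m + 1)) (y : ℝ) : Fin (m + 3) → ℝ :=
  fun t =>
    if h1 : (t : ℕ) ≤ (j : ℕ) then c ⟨t, by have := j.isLt; omega⟩
    else if (t : ℕ) = (j : ℕ) + 1 then y
    else c ⟨(t : ℕ) - 1, by have := t.isLt; omega⟩

/-- Playing a BC protocol: given the sorted cut points made so far, the execution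
history, and a strategy profile, compute the final list of (interval, agent) pairs. -/
def BCTree.playAlloc {n : ℕ} : {m : ℕ} → BCTree n m → (Fin (m + 2) → ℝ) → Hist →
    (Fin n → BCStrategy) → List (ℝ × ℝ × Fin n)
  | m, .leaf alloc, c, _, _ =>
      (List.finRange (m + 1)).map fun t => (c t.castSucc, c t.succ, alloc t)
  | _, .cut i j child, c, h, σ =>
      let y := max (c j.castSucc) (min ((σ i).cutAt h) (c j.succ))
      child.playAlloc (insertPt c j y) (h ++ [Sum.inl y]) σ
  | _, @BCTree.choose _ _ i k children, c, h, σ =>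
      let t : Fin (k + 1) := ⟨(σ i).chooseAt h % (k + 1), Nat.mod_lt _ (Nat.succ_pos k)⟩
      (children t).playAlloc c (h ++ [Sum.inr (t : ℕ)]) σ

/-- The extensive-form game determined by a BC protocol. -/
def BCTree.toGame {n : ℕ} (t : BCTree n 0) : GameForm n where
  Strategy := fun _ => BCStrategy
  play := fun σ => allocOf (t.playAlloc initPts [] σ)

/-! ## Extended BC protocols -/

/-- An extended BC protocol tree over `n` agents, indexed by the number of cuts made
so far.  Cut points are referred to by their index of creation (index `0` is the point
`0`, index `1` is the point `1`, and index `t+2` is the `t`-th cut made).  At a `cut`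
node the designated agent makes one cut anywhere between the two existing (possibly
non-consecutive) cut points `a` and `b`; at a `choose` node the designated agent
selects which child the execution proceeds to; a `leaf` allocates, for each listed
pair of existing cut points, the whole piece of cake lying between them to the listed
agent. -/
inductive ExtTree (n : ℕ) : ℕ → Type
  | leaf {m : ℕ} (alloc : List (Fin (m + 2) × Fin (m + 2) × Fin n)) : ExtTree n m
  | cut {m : ℕ} (agent : Fin n) (a b : Fin (m + 2)) (child : ExtTree n (m + 1)) : ExtTree n m
  | choose {m : ℕ} (agent : Fin n) {k : ℕ} (children : Fin (k + 1) → ExtTree n m) : ExtTree n m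

/-- Record a newly created cut point `y`. -/
def extendPt {m : ℕ} (p : Fin (m + 2) → ℝ) (y : ℝ) : Fin (m + 3) → ℝ :=
  fun t => if h : (t : ℕ) < m + 2 then p ⟨t, h⟩ else y

/-- Playing an extended BC protocol: given the cut points made so far (indexed by
creation order), the execution history and a strategy profile, compute the final list
of (interval, agent) pairs. -/
def ExtTree.playAlloc {n : ℕ} : {m : ℕ} → ExtTree n m → (Fin (m + 2) → ℝ) → Hist →
    (Fin n → BCStrategy) → List (ℝ × ℝ × Fin n)
  | _, .leaf alloc, p, _, _ => alloc.map fun q => (p q.1, p q.2.1, q.2.2)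
  | _, .cut i a b child, p, h, σ =>
      let lo := min (p a) (p b)
      let hi := max (p a) (p b)
      let y := max lo (min ((σ i).cutAt h) hi)
      child.playAlloc (extendPt p y) (h ++ [Sum.inl y]) σ
  | _, @ExtTree.choose _ _ i k children, p, h, σ =>
      let t : Fin (k + 1) := ⟨(σ i).chooseAt h % (k + 1), Nat.mod_lt _ (Nat.succ_pos k)⟩
      (children t).playAlloc p (h ++ [Sum.inr (t : ℕ)]) σ

/-- A list of (interval, agent) pairs partitions the cake `[0,1]`: it can be reordered
into a sequence of intervals with nonnegative lengths, chained end to end from `0`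
to `1`.  In particular, for each listed piece the left endpoint is at most the right
endpoint. -/
def PartitionsCake {n : ℕ} (L : List (ℝ × ℝ × Fin n)) : Prop :=
  ∃ L' : List (ℝ × ℝ × Fin n), L'.Perm L ∧
    (∀ q ∈ L', q.1 ≤ q.2.1) ∧
    List.Chain' (fun q r => q.2.1 = r.1) L' ∧
    (L'.head?.map fun q => q.1) = some 0 ∧
    (L'.getLast?.map fun q => q.2.1) = some 1

/-- An extended BC protocol: an extended BC tree which is well formed, i.e. whatever
the agents do, at the leaf reached, each allocated piece lies between cut points
`x ≤ y` and the allocated pieces partition the entire cake. -/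
structure ExtProtocol (n : ℕ) where
  tree : ExtTree n 0
  valid : ∀ σ : Fin n → BCStrategy, PartitionsCake (tree.playAlloc initPts [] σ)

/-- The extensive-form game determined by an extended BC protocol. -/
def ExtProtocol.toGame {n : ℕ} (E : ExtProtocol n) : GameForm n where
  Strategy := fun _ => BCStrategy
  play := fun σ => allocOf (E.tree.playAlloc initPts [] σ)

/-- The number of nodes of an extended BC tree. -/
def ExtTree.size {n : ℕ} : {m : ℕ} → ExtTree n m → ℕ
  | _, .leaf _ => 1
  | _, .cut _ _ _ child => child.size + 1
  | _, @ExtTree.choose _ _ _ k children => (∑ t : Fin (k + 1), (children t).size) + 1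

/-- An extended BC tree contains a cut node. -/
def ExtTree.hasCut {n : ℕ} : {m : ℕ} → ExtTree n m → Prop
  | _, .leaf _ => False
  | _, .cut _ _ _ _ => True
  | _, @ExtTree.choose _ _ _ _ children => ∃ t, (children t).hasCut

/-- No choose node of the tree has a cut node among its descendants. -/
def ExtTree.cutsBeforeChoices {n : ℕ} : {m : ℕ} → ExtTree n m → Prop
  | _, .leaf _ => True
  | _, .cut _ _ _ child => child.cutsBeforeChoices
  | _, @ExtTree.choose _ _ _ _ children => ∀ t, ¬ (children t).hasCut

/-! ## Abstract game trees -/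

/-- Abstract game tree: at a node the agent's (cut, choice) answer is normalised by `val`
to a move, which is recorded in the history and selects the child. -/
inductive GTree (n : ℕ) : Type
  | leaf (L : List (ℝ × ℝ × Fin n)) : GTree n
  | node (i : Fin n) (val : ℝ × ℕ → ℝ ⊕ ℕ) (child : ℝ ⊕ ℕ → GTree n) : GTree n

namespace GTree

def play {n : ℕ} : GTree n → Hist → (Fin n → BCStrategy) → List (ℝ × ℝ × Fin n)
  | .leaf L, _, _ => L
  | .node i val child, h, σ =>
      (child (val ((σ i).cutAt h, (σ i).chooseAt h))).play
        (h ++ [val ((σ i).cutAt h, (σ i).chooseAt h)]) σ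

/-- The coalition `C` can force `Q`. -/
def Win {n : ℕ} (C : Fin n → Prop) (Q : List (ℝ × ℝ × Fin n) → Prop) : GTree n → Prop
  | .leaf L => Q L
  | .node i val child =>
      (C i → ∃ x, (child (val x)).Win C Q) ∧ (¬ C i → ∀ x, (child (val x)).Win C Q)

def AgreeFrom (h : Hist) (s t : BCStrategy) : Prop :=
  ∀ h', h <+: h' → s.cutAt h' = t.cutAt h' ∧ s.chooseAt h' = t.chooseAt h'

theorem not_prefix_append {h : Hist} {m : ℝ ⊕ ℕ} : ¬ (h ++ [m] <+: h) := by
  intro hp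
  have := hp.length_le
  simp at this

theorem play_congr {n : ℕ} (g : GTree n) : ∀ (h : Hist) (σ τ : Fin n → BCStrategy),
    (∀ i, AgreeFrom h (σ i) (τ i)) → g.play h σ = g.play h τ := by
  induction g with
  | leaf L => intros; rfl
  | node i val child ih =>
    intro h σ τ hst
    have h0 := hst i h (List.prefix_refl h)
    simp only [play]
    rw [h0.1, h0.2]
    apply ih
    intro j h' hh'
    exact hst j h' ((List.prefix_append h _).trans hh')

theorem forces_iff_win {n : ℕ} (C : Fin n → Prop) (Q : List (ℝ × ℝ × Fin n) → Prop)
    (g : GTree n) : ∀ h : Hist,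
    (∃ τ : Fin n → BCStrategy, ∀ σ : Fin n → BCStrategy,
      (∀ i, C i → AgreeFrom h (σ i) (τ i)) → Q (g.play h σ)) ↔ g.Win C Q := by
  classical
  induction g with
  | leaf L =>
    intro h
    simp only [play, Win]
    constructor
    · rintro ⟨τ, hτ⟩
      exact hτ τ (fun i _ h' _ => ⟨rfl, rfl⟩)
    · intro hQ
      exact ⟨fun _ => ⟨fun _ => 0, fun _ => 0⟩, fun _ _ => hQ⟩
  | node i val child ih =>
    intro h
    constructor
    · rintro ⟨τ, hτ⟩
      -- for a prescribed answer `x` compatible with `τ`, the child is won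
      have key : ∀ x : ℝ × ℕ, (C i → x = ((τ i).cutAt h, (τ i).chooseAt h)) →
          (child (val x)).Win C Q := by
        intro x hx
        rw [← ih (val x) (h ++ [val x])]
        refine ⟨τ, fun σ hσ => ?_⟩
        let σ' : Fin n → BCStrategy := fun j =>
          ⟨fun h' => if h' = h then (if j = i then x.1 else (τ j).cutAt h')
              else if h ++ [val x] <+: h' then (σ j).cutAt h' else (τ j).cutAt h',
           fun h' => if h' = h then (if j = i then x.2 else (τ j).chooseAt h')
              else if h ++ [val x] <+: h' then (σ j).chooseAt h' else (τ j).chooseAt h'⟩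
        have h1 := hτ σ' (by
          intro j hj h' hh'
          by_cases e : h' = h
          · subst e
            by_cases e2 : j = i
            · subst e2
              have := hx hj
              simp [σ', this]
            · simp [σ', e2]
          · by_cases e3 : h ++ [val x] <+: h'
            · simpa [σ', e, e3] using hσ j hj h' e3
            · simp [σ', e, e3])
        have e1 : (σ' i).cutAt h = x.1 := by simp [σ']
        have e2 : (σ' i).chooseAt h = x.2 := by simp [σ']
        simp only [play, e1, e2] at h1
        rw [play_congr _ _ σ σ']
        · exact h1
        · intro j h' hh'
          have : h' ≠ h := by
            rintro rfl
            exact not_prefix_append hh'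
          simp [σ', this, hh']
      exact ⟨fun hC => ⟨_, key _ (fun _ => rfl)⟩, fun hC x => key x (fun h => absurd h hC)⟩
    · rintro ⟨hw1, hw2⟩
      have hch : ∀ m : ℝ ⊕ ℕ, ∃ τ : Fin n → BCStrategy, (child m).Win C Q →
          ∀ σ : Fin n → BCStrategy, (∀ i, C i → AgreeFrom (h ++ [m]) (σ i) (τ i)) →
            Q ((child m).play (h ++ [m]) σ) := by
        intro m
        by_cases hm : (child m).Win C Q
        · obtain ⟨τ, hτ⟩ := (ih m (h ++ [m])).2 hm
          exact ⟨τ, fun _ => hτ⟩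
        · exact ⟨fun _ => ⟨fun _ => 0, fun _ => 0⟩, fun h => absurd h hm⟩
      choose T hT using hch
      have hx : ∃ x : ℝ × ℕ, C i → (child (val x)).Win C Q := by
        by_cases hC : C i
        · obtain ⟨x, hx⟩ := hw1 hC
          exact ⟨x, fun _ => hx⟩
        · exact ⟨(0, 0), fun h => absurd h hC⟩
      obtain ⟨x, hx⟩ := hx
      let τ : Fin n → BCStrategy := fun j =>
        ⟨fun h' => match h'[h.length]? with
          | none => x.1
          | some m => (T m j).cutAt h',
         fun h' => match h'[h.length]? with
          | none => x.2
          | some m => (T m j).chooseAt h'⟩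
      refine ⟨τ, fun σ hσ => ?_⟩
      simp only [play]
      have hwin : (child (val ((σ i).cutAt h, (σ i).chooseAt h))).Win C Q := by
        by_cases hC : C i
        · have h0 := hσ i hC h (List.prefix_refl h)
          have e1 : (τ i).cutAt h = x.1 := by simp [τ]
          have e2 : (τ i).chooseAt h = x.2 := by simp [τ]
          rw [h0.1, h0.2, e1, e2]
          exact hx hC
        · exact hw2 hC _
      apply hT _ hwin
      intro j hj h' hh'
      have h0 := hσ j hj h' ((List.prefix_append h _).trans hh')
      obtain ⟨r, rfl⟩ := hh'
      rw [h0.1, h0.2]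
      simp [τ]

end GTree

/-! ## Unrolling protocols into abstract game trees -/

def clampR (lo hi x : ℝ) : ℝ := max lo (min x hi)

def ExtTree.toG {n : ℕ} : {m : ℕ} → ExtTree n m → (Fin (m + 2) → ℝ) → GTree n
  | _, .leaf alloc, p => .leaf (alloc.map fun q => (p q.1, p q.2.1, q.2.2))
  | _, .cut i a b child, p =>
      .node i (fun x => Sum.inl (clampR (min (p a) (p b)) (max (p a) (p b)) x.1))
        (fun y => match y with
          | .inl y => child.toG (extendPt p y)
          | .inr _ => .leaf [])
  | _, @ExtTree.choose _ _ i k children, p =>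
      .node i (fun x => Sum.inr (x.2 % (k + 1)))
        (fun y => match y with
          | .inl _ => .leaf []
          | .inr t => (children ⟨t % (k + 1), Nat.mod_lt _ (Nat.succ_pos k)⟩).toG p)

def BCTree.toG {n : ℕ} : {m : ℕ} → BCTree n m → (Fin (m + 2) → ℝ) → GTree n
  | m, .leaf alloc, c =>
      .leaf ((List.finRange (m + 1)).map fun t => (c t.castSucc, c t.succ, alloc t))
  | _, .cut i j child, c =>
      .node i (fun x => Sum.inl (clampR (c j.castSucc) (c j.succ) x.1))
        (fun y => match y with
          | .inl y => child.toG (insertPt c j y)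
          | .inr _ => .leaf [])
  | _, @BCTree.choose _ _ i k children, c =>
      .node i (fun x => Sum.inr (x.2 % (k + 1)))
        (fun y => match y with
          | .inl _ => .leaf []
          | .inr t => (children ⟨t % (k + 1), Nat.mod_lt _ (Nat.succ_pos k)⟩).toG c)

theorem ExtTree.play_toG {n m : ℕ} (t : ExtTree n m) : ∀ (p : Fin (m + 2) → ℝ) (h : Hist)
    (σ : Fin n → BCStrategy), t.playAlloc p h σ = (t.toG p).play h σ := by
  induction t with
  | leaf alloc => intros; rfl
  | cut i a b child ih => intro p h σ; exact ih _ _ _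
  | choose i children ih =>
    intro p h σ
    simp only [ExtTree.playAlloc, ExtTree.toG, GTree.play, Nat.mod_mod]
    exact ih _ _ _ _

theorem BCTree.play_toG {n m : ℕ} (t : BCTree n m) : ∀ (p : Fin (m + 2) → ℝ) (h : Hist)
    (σ : Fin n → BCStrategy), t.playAlloc p h σ = (t.toG p).play h σ := by
  induction t with
  | leaf alloc => intros; rfl
  | cut i j child ih => intro p h σ; exact ih _ _ _
  | choose i children ih =>
    intro p h σ
    simp only [BCTree.playAlloc, BCTree.toG, GTree.play, Nat.mod_mod]
    exact ih _ _ _ _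

/-! ## Win conditions on trees -/

theorem ExtTree.win_cut {n m : ℕ} (C : Fin n → Prop) (Q : List (ℝ × ℝ × Fin n) → Prop)
    (i : Fin n) (a b : Fin (m + 2)) (child : ExtTree n (m + 1)) (p : Fin (m + 2) → ℝ) :
    ((ExtTree.cut i a b child).toG p).Win C Q ↔
      (C i → ∃ x : ℝ, (child.toG (extendPt p
        (clampR (min (p a) (p b)) (max (p a) (p b)) x))).Win C Q) ∧
      (¬ C i → ∀ x : ℝ, (child.toG (extendPt p
        (clampR (min (p a) (p b)) (max (p a) (p b)) x))).Win C Q) := by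
  simp only [ExtTree.toG, GTree.Win, Prod.exists, Prod.forall, exists_const, forall_const]

theorem BCTree.win_cut {n m : ℕ} (C : Fin n → Prop) (Q : List (ℝ × ℝ × Fin n) → Prop)
    (i : Fin n) (j : Fin (m + 1)) (child : BCTree n (m + 1)) (c : Fin (m + 2) → ℝ) :
    ((BCTree.cut i j child).toG c).Win C Q ↔
      (C i → ∃ x : ℝ, (child.toG (insertPt c j
        (clampR (c j.castSucc) (c j.succ) x))).Win C Q) ∧
      (¬ C i → ∀ x : ℝ, (child.toG (insertPt c j
        (clampR (c j.castSucc) (c j.succ) x))).Win C Q) := by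
  simp only [BCTree.toG, GTree.Win, Prod.exists, Prod.forall, exists_const, forall_const]

theorem exists_mod_iff {k : ℕ} (P : Fin (k + 1) → Prop) :
    (∃ t : ℝ × ℕ, P ⟨t.2 % (k + 1), Nat.mod_lt _ (Nat.succ_pos k)⟩) ↔ ∃ t, P t := by
  constructor
  · rintro ⟨t, ht⟩; exact ⟨_, ht⟩
  · rintro ⟨t, ht⟩
    refine ⟨(0, t), ?_⟩
    convert ht using 1
    exact Fin.ext (Nat.mod_eq_of_lt t.2)

theorem forall_mod_iff {k : ℕ} (P : Fin (k + 1) → Prop) :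
    (∀ t : ℝ × ℕ, P ⟨t.2 % (k + 1), Nat.mod_lt _ (Nat.succ_pos k)⟩) ↔ ∀ t, P t := by
  constructor
  · intro h t
    convert h (0, t) using 1
    exact Fin.ext (Nat.mod_eq_of_lt t.2).symm
  · intro h t; exact h _

theorem ExtTree.win_choose {n m k : ℕ} (C : Fin n → Prop) (Q : List (ℝ × ℝ × Fin n) → Prop)
    (i : Fin n) (children : Fin (k + 1) → ExtTree n m) (p : Fin (m + 2) → ℝ) :
    ((ExtTree.choose i children).toG p).Win C Q ↔
      (C i → ∃ t, ((children t).toG p).Win C Q) ∧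
      (¬ C i → ∀ t, ((children t).toG p).Win C Q) := by
  simp only [ExtTree.toG, GTree.Win, Nat.mod_mod]
  rw [exists_mod_iff (fun t => ((children t).toG p).Win C Q),
    forall_mod_iff (fun t => ((children t).toG p).Win C Q)]

theorem BCTree.win_choose {n m k : ℕ} (C : Fin n → Prop) (Q : List (ℝ × ℝ × Fin n) → Prop)
    (i : Fin n) (children : Fin (k + 1) → BCTree n m) (p : Fin (m + 2) → ℝ) :
    ((BCTree.choose i children).toG p).Win C Q ↔
      (C i → ∃ t, ((children t).toG p).Win C Q) ∧
      (¬ C i → ∀ t, ((children t).toG p).Win C Q) := by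
  simp only [BCTree.toG, GTree.Win, Nat.mod_mod]
  rw [exists_mod_iff (fun t => ((children t).toG p).Win C Q),
    forall_mod_iff (fun t => ((children t).toG p).Win C Q)]

/-! ## The translation -/

/-- The allocated piece `q` covers the `t`-th contiguous piece. -/
def Covers {n m m' : ℕ} (pos : Fin (m + 2) → Fin (m' + 2)) (t : Fin (m' + 1))
    (q : Fin (m + 2) × Fin (m + 2) × Fin n) : Bool :=
  decide ((pos q.1 : ℕ) ≤ t ∧ (t : ℕ) < pos q.2.1)

/-- Positions of the existing cut points and of a new one made in piece `j`. -/
def newPos {m m' : ℕ} (pos : Fin (m + 2) → Fin (m' + 2)) (j : Fin (m' + 1)) :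
    Fin (m + 3) → Fin (m' + 3) :=
  fun s => if h : (s : ℕ) < m + 2 then
      (if (pos ⟨s, h⟩ : ℕ) ≤ j then (pos ⟨s, h⟩).castSucc else (pos ⟨s, h⟩).succ)
    else j.succ.castSucc

/-- Positions of the existing cut points and of a new one coinciding with position `a`. -/
def samePos {m m' : ℕ} (pos : Fin (m + 2) → Fin (m' + 2)) (a : Fin (m' + 2)) :
    Fin (m + 3) → Fin (m' + 2) :=
  fun s => if h : (s : ℕ) < m + 2 then pos ⟨s, h⟩ else a

def pieceIdx {m' : ℕ} (x y : Fin (m' + 2)) (hxy : x ≠ y)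
    (t : Fin (((max x y : Fin (m' + 2)) : ℕ) - (min x y : Fin (m' + 2)) - 1 + 1)) :
    Fin (m' + 1) :=
  ⟨(min x y : Fin (m' + 2)) + t, by
    have h1 := t.2
    have h2 : min x y < max x y := min_lt_max.2 hxy
    have h3 := (max x y).2
    have h4 : ((min x y : Fin (m' + 2)) : ℕ) < (max x y : Fin (m' + 2)) := h2
    omega⟩

def toBC {n : ℕ} (d : Fin n) : {m : ℕ} → ExtTree n m → (m' : ℕ) →
    (Fin (m + 2) → Fin (m' + 2)) → BCTree n m'
  | _, .leaf alloc, _, pos =>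
      .leaf fun t => (((alloc.filter (Covers pos t)).head?).map fun q => q.2.2).getD d
  | _, .cut i a b child, m', pos =>
      if hab : pos a = pos b then toBC d child m' (samePos pos (pos a))
      else .choose i fun t =>
        .cut i (pieceIdx (pos a) (pos b) hab t)
          (toBC d child (m' + 1) (newPos pos (pieceIdx (pos a) (pos b) hab t)))
  | _, @ExtTree.choose _ _ i _ children, m', pos =>
      .choose i fun t => toBC d (children t) m' pos

/-! ## Combinatorics of positions -/

theorem extendPt_newPos {m m' : ℕ} (pos : Fin (m + 2) → Fin (m' + 2)) (c : Fin (m' + 2) → ℝ)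
    (j : Fin (m' + 1)) (y : ℝ) :
    extendPt (c ∘ pos) y = insertPt c j y ∘ newPos pos j := by
  funext s
  simp only [extendPt, insertPt, newPos, Function.comp]
  by_cases h : (s : ℕ) < m + 2
  · by_cases h2 : (pos ⟨s, h⟩ : ℕ) ≤ j
    · simp [h, h2]
    · have h3 : ¬ ((pos ⟨s, h⟩ : ℕ) + 1 ≤ j) := by omega
      simp [h, h2, h3]
      intro h4
      omega
  · simp [h]

theorem extendPt_samePos {m m' : ℕ} (pos : Fin (m + 2) → Fin (m' + 2)) (c : Fin (m' + 2) → ℝ)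
    (a : Fin (m' + 2)) :
    extendPt (c ∘ pos) (c a) = c ∘ samePos pos a := by
  funext s
  simp only [extendPt, samePos, Function.comp]
  by_cases h : (s : ℕ) < m + 2 <;> simp [h]

theorem insertPt_monotone {m : ℕ} {c : Fin (m + 2) → ℝ} (hc : Monotone c) (j : Fin (m + 1))
    {y : ℝ} (h1 : c j.castSucc ≤ y) (h2 : y ≤ c j.succ) : Monotone (insertPt c j y) := by
  intro s t hst
  have hst' : (s : ℕ) ≤ t := hst
  simp only [insertPt]
  split_ifs with a1 a2 a3 a4 a5 a6 a7
  · exact hc hst'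
  · exact (hc (show _ ≤ j.castSucc from a1)).trans h1
  · exact hc (show (s : ℕ) ≤ (t : ℕ) - 1 by omega)
  · omega
  · exact le_rfl
  · exact h2.trans (hc (show (j : ℕ) + 1 ≤ (t : ℕ) - 1 by omega))
  · omega
  · omega
  · exact hc (show (s : ℕ) - 1 ≤ (t : ℕ) - 1 by omega)

theorem insertPt_strictMono {m : ℕ} {c : Fin (m + 2) → ℝ} (hc : StrictMono c)
    (j : Fin (m + 1))
    {y : ℝ} (h1 : c j.castSucc < y) (h2 : y < c j.succ) : StrictMono (insertPt c j y) := by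
  intro s t hst
  have hst' : (s : ℕ) < t := hst
  simp only [insertPt]
  split_ifs with a1 a2 a3 a4 a5 a6 a7
  · exact hc hst'
  · exact (hc.monotone (show _ ≤ j.castSucc from a1)).trans_lt h1
  · exact hc (show (s : ℕ) < (t : ℕ) - 1 by omega)
  · omega
  · omega
  · exact h2.trans_le (hc.monotone (show (j : ℕ) + 1 ≤ (t : ℕ) - 1 by omega))
  · omega
  · omega
  · exact hc (show (s : ℕ) - 1 < (t : ℕ) - 1 by omega)

theorem insertPt_zero {m : ℕ} (c : Fin (m + 2) → ℝ) (j : Fin (m + 1)) (y : ℝ) :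
    insertPt c j y 0 = c 0 := by
  simp [insertPt]

theorem insertPt_last {m : ℕ} (c : Fin (m + 2) → ℝ) (j : Fin (m + 1)) (y : ℝ) :
    insertPt c j y (Fin.last _) = c (Fin.last _) := by
  have := j.2
  have h1 : ¬ (m + 2 ≤ (j : ℕ)) := by omega
  have h2 : ¬ (m + 1 = (j : ℕ)) := by omega
  simp [insertPt, h1, h2]
  rfl

theorem clampR_of_mem {lo hi x : ℝ} (h1 : lo ≤ x) (h2 : x ≤ hi) : clampR lo hi x = x := by
  simp [clampR, h1, h2]

theorem le_clampR {lo hi x : ℝ} : lo ≤ clampR lo hi x := le_max_left _ _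

theorem clampR_le {lo hi x : ℝ} (h : lo ≤ hi) : clampR lo hi x ≤ hi :=
  max_le h (min_le_right _ _)

theorem pieceIdx_lo {m' : ℕ} (x y : Fin (m' + 2)) (hxy : x ≠ y) (t) :
    min x y ≤ (pieceIdx x y hxy t).castSucc := by
  change ((min x y : Fin (m' + 2)) : ℕ) ≤ (min x y : Fin (m' + 2)) + t
  omega

theorem pieceIdx_hi {m' : ℕ} (x y : Fin (m' + 2)) (hxy : x ≠ y) (t) :
    (pieceIdx x y hxy t).succ ≤ max x y := by
  change ((min x y : Fin (m' + 2)) : ℕ) + t + 1 ≤ (max x y : Fin (m' + 2))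
  have h1 := t.2
  have h4 : ((min x y : Fin (m' + 2)) : ℕ) < (max x y : Fin (m' + 2)) :=
    Fin.lt_def.1 (min_lt_max.2 hxy)
  omega

/-- A point between two cut points lies in one of the pieces between them. -/
theorem exists_piece {m' : ℕ} (c : Fin (m' + 2) → ℝ) (x y : Fin (m' + 2))
    (hxy : x ≠ y) (z : ℝ) (h1 : c (min x y) ≤ z) (h2 : z ≤ c (max x y)) :
    ∃ t, c (pieceIdx x y hxy t).castSucc ≤ z ∧ z ≤ c (pieceIdx x y hxy t).succ := by
  have h4 : ((min x y : Fin (m' + 2)) : ℕ) < (max x y : Fin (m' + 2)) :=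
    Fin.lt_def.1 (min_lt_max.2 hxy)
  by_contra hcon
  push Not at hcon
  have key : ∀ k : ℕ, ∀ hk : (min x y : Fin (m' + 2)) + k ≤ ((max x y : Fin (m' + 2)) : ℕ),
      c ⟨(min x y : Fin (m' + 2)) + k, by have := (max x y).2; omega⟩ ≤ z := by
    intro k
    induction k with
    | zero => intro _; exact h1
    | succ k ih =>
      intro hk
      exact (hcon ⟨k, by omega⟩ (ih (by omega))).le
  set K := ((max x y : Fin (m' + 2)) : ℕ) - (min x y : Fin (m' + 2)) - 1 with hK
  have h5 := hcon ⟨K, by omega⟩ (key K (by omega))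
  have h6 : (pieceIdx x y hxy ⟨K, by omega⟩).succ = max x y := by
    apply Fin.ext
    change ((min x y : Fin (m' + 2)) : ℕ) + K + 1 = (max x y : Fin (m' + 2))
    omega
  rw [h6] at h5
  linarith

/-! ## Leaves -/

theorem chain_countP {n : ℕ} (z : ℝ) : ∀ (L : List (ℝ × ℝ × Fin n)) (x w : ℝ),
    (∀ q ∈ L, q.1 ≤ q.2.1) → List.IsChain (fun q r => q.2.1 = r.1) L →
    (L.head?.map fun q => q.1) = some x → (L.getLast?.map fun q => q.2.1) = some w →
    x ≤ w ∧ L.countP (fun q => decide (q.1 ≤ z ∧ z < q.2.1)) = if x ≤ z ∧ z < w then 1 else 0 := by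
  intro L
  induction L with
  | nil => intro x w _ _ h; simp at h
  | cons q L ih =>
    intro x w hle hch hh hl
    simp at hh
    subst hh
    cases L with
    | nil =>
      simp at hl
      subst hl
      refine ⟨hle q (by simp), ?_⟩
      simp [List.countP_cons]
    | cons r L =>
      rw [List.isChain_cons_cons] at hch
      have hr := ih r.1 w (fun q hq => hle q (List.mem_cons_of_mem _ hq)) hch.2 (by simp)
        (by simpa [List.getLast?_cons_cons] using hl)
      have hq := hle q (by simp)
      have he := hch.1
      refine ⟨by linarith [hr.1], ?_⟩
      rw [List.countP_cons, hr.2]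
      have := hr.1
      simp only [decide_eq_true_eq]
      split_ifs <;> first | rfl | (exfalso; grind)

theorem partitions_countP {n : ℕ} {L : List (ℝ × ℝ × Fin n)} (h : PartitionsCake L)
    (z : ℝ) (h0 : 0 ≤ z) (h1 : z < 1) :
    L.countP (fun q => decide (q.1 ≤ z ∧ z < q.2.1)) = 1 := by
  obtain ⟨L', hp, hle, hch, hh, hl⟩ := h
  rw [← hp.countP_eq, (chain_countP z L' 0 1 hle hch hh hl).2]
  simp [h0, h1]

theorem pieceValue_allocOf {n : ℕ} (V : CakeValuation) (L : List (ℝ × ℝ × Fin n)) (a : Fin n) :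
    pieceValue V (allocOf L a) =
      (L.map fun q => if q.2.2 = a then V.v q.1 q.2.1 else 0).sum := by
  induction L with
  | nil => simp [pieceValue, allocOf]
  | cons q L ih =>
    simp only [pieceValue, allocOf] at ih ⊢
    by_cases h : q.2.2 = a
    · simp [h, ← ih]
    · simp [h, ← ih]

/-- Additivity over consecutive pieces. -/
theorem value_sum {m' : ℕ} (V : CakeValuation) (c : Fin (m' + 2) → ℝ) (hc : Monotone c)
    (h0 : c 0 = 0) (h1 : c (Fin.last _) = 1) (x y : Fin (m' + 2)) (hxy : x ≤ y) :
    V.v (c x) (c y) = ∑ t : Fin (m' + 1),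
      if (x : ℕ) ≤ t ∧ (t : ℕ) < y then V.v (c t.castSucc) (c t.succ) else 0 := by
  have hc0 : ∀ s, 0 ≤ c s := fun s => h0 ▸ hc (Fin.zero_le s)
  have hc1 : ∀ s, c s ≤ 1 := fun s => h1 ▸ hc (Fin.le_last s)
  induction y using Fin.induction with
  | zero =>
    have : x = 0 := le_antisymm hxy (Fin.zero_le x)
    subst this
    have := V.additive (c 0) (c 0) (c 0) (hc0 _) le_rfl le_rfl (hc1 _)
    simp
    linarith
  | succ y ih =>
    rcases eq_or_lt_of_le hxy with rfl | hlt
    · have := V.additive (c y.succ) (c y.succ) (c y.succ) (hc0 _) le_rfl le_rfl (hc1 _)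
      rw [Finset.sum_eq_zero]
      · linarith
      · intro t _
        rw [if_neg]
        omega
    · have hle : x ≤ y.castSucc := Fin.le_castSucc_iff.2 hlt
      have hle' : (x : ℕ) ≤ y := hle
      have hadd := V.additive (c x) (c y.castSucc) (c y.succ) (hc0 _) (hc hle)
        (hc y.castSucc_le_succ) (hc1 _)
      rw [← hadd, ih hle]
      have : ∀ t : Fin (m' + 1),
          (if (x : ℕ) ≤ t ∧ (t : ℕ) < y.succ then V.v (c t.castSucc) (c t.succ) else 0) =
          (if (x : ℕ) ≤ t ∧ (t : ℕ) < y.castSucc then V.v (c t.castSucc) (c t.succ) else 0) +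
          (if t = y then V.v (c t.castSucc) (c t.succ) else 0) := by
        intro t
        simp only [Fin.val_succ, Fin.val_castSucc]
        by_cases e : t = y
        · subst e
          simp [hle']
        · have e' : (t : ℕ) ≠ y := fun h => e (Fin.ext h)
          have : ((t : ℕ) < y + 1) ↔ (t : ℕ) < y := by omega
          simp [e, this]
      simp only [this, Finset.sum_add_distrib]
      simp

theorem sum_map_finset_sum {α ι : Type} [Fintype ι] (l : List α) (f : α → ι → ℝ) :
    (l.map fun q => ∑ t, f q t).sum = ∑ t, (l.map fun q => f q t).sum := by
  induction l with
  | nil => simp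
  | cons a l ih => simp [ih, Finset.sum_add_distrib]

theorem sum_map_filter {α : Type} (l : List α) (P : α → Bool) (f : α → ℝ) :
    (l.map fun q => if P q then f q else 0).sum = ((l.filter P).map f).sum := by
  induction l with
  | nil => simp
  | cons a l ih => by_cases h : P a <;> simp [h, ih]

theorem leaf_value {n m m' : ℕ} (d : Fin n) (alloc : List (Fin (m + 2) × Fin (m + 2) × Fin n))
    (pos : Fin (m + 2) → Fin (m' + 2)) (c0 : Fin (m' + 2) → ℝ) (hc0 : StrictMono c0)
    (h00 : c0 0 = 0) (h01 : c0 (Fin.last _) = 1)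
    (hval : PartitionsCake (alloc.map fun q => ((c0 ∘ pos) q.1, (c0 ∘ pos) q.2.1, q.2.2)))
    (c : Fin (m' + 2) → ℝ) (hc : Monotone c) (h0 : c 0 = 0) (h1 : c (Fin.last _) = 1)
    (V : CakeValuation) (a : Fin n) :
    pieceValue V (allocOf (alloc.map fun q => ((c ∘ pos) q.1, (c ∘ pos) q.2.1, q.2.2)) a) =
    pieceValue V (allocOf ((List.finRange (m' + 1)).map fun t => (c t.castSucc, c t.succ,
      (((alloc.filter (Covers pos t)).head?).map fun q => q.2.2).getD d)) a) := by
  have hord : ∀ q ∈ alloc, pos q.1 ≤ pos q.2.1 := by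
    intro q hq
    obtain ⟨L', hp, hle, _⟩ := hval
    have := hle ((c0 ∘ pos) q.1, (c0 ∘ pos) q.2.1, q.2.2)
      (hp.mem_iff.2 (List.mem_map.2 ⟨q, hq, rfl⟩))
    exact hc0.le_iff_le.1 this
  have hcov : ∀ t : Fin (m' + 1), ∃ q, alloc.filter (Covers pos t) = [q] := by
    intro t
    rw [← List.length_eq_one_iff, ← List.countP_eq_length_filter]
    have hz1 : 0 ≤ c0 t.castSucc := h00 ▸ hc0.monotone (Fin.zero_le _)
    have hz2 : c0 t.castSucc < 1 := h01 ▸ hc0 (Fin.castSucc_lt_last t)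
    rw [← partitions_countP hval (c0 t.castSucc) hz1 hz2, List.countP_map]
    apply List.countP_congr
    intro q _
    simp only [Covers, Function.comp, decide_eq_true_eq, hc0.le_iff_le, hc0.lt_iff_lt]
    rfl
  rw [pieceValue_allocOf, pieceValue_allocOf, List.map_map, List.map_map]
  have e1 : (alloc.map ((fun q : ℝ × ℝ × Fin n => if q.2.2 = a then V.v q.1 q.2.1 else 0) ∘
      fun q => ((c ∘ pos) q.1, (c ∘ pos) q.2.1, q.2.2))) =
      alloc.map fun q => ∑ t : Fin (m' + 1), if Covers pos t q then
        (if q.2.2 = a then V.v (c t.castSucc) (c t.succ) else 0) else 0 := by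
    apply List.map_congr_left
    intro q hq
    simp only [Function.comp, Covers, decide_eq_true_eq]
    by_cases e : q.2.2 = a
    · simp only [e, if_true]
      exact value_sum V c hc h0 h1 _ _ (hord q hq)
    · simp [e]
  rw [e1, sum_map_finset_sum, ← List.ofFn_eq_map, List.sum_ofFn]
  apply Finset.sum_congr rfl
  intro t _
  rw [sum_map_filter]
  obtain ⟨q, hq⟩ := hcov t
  simp only [Function.comp, hq]
  by_cases e : q.2.2 = a <;> simp [e]

/-! ## Main induction -/

theorem quant_equiv {X U Y : Type} {K : Prop} {A : X → Prop} {B : U → Y → Prop}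
    (h1 : ∀ x, ∃ u y, (A x ↔ B u y)) (h2 : ∀ u y, ∃ x, (A x ↔ B u y)) :
    ((K → ∃ x, A x) ∧ (¬ K → ∀ x, A x)) ↔
    ((K → ∃ u, (K → ∃ y, B u y) ∧ (¬ K → ∀ y, B u y)) ∧
      (¬ K → ∀ u, (K → ∃ y, B u y) ∧ (¬ K → ∀ y, B u y))) := by
  by_cases hK : K
  · simp only [hK, true_implies, not_true, false_implies, and_true]
    constructor
    · rintro ⟨x, hx⟩
      obtain ⟨u, y, h⟩ := h1 x
      exact ⟨u, y, h.1 hx⟩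
    · rintro ⟨u, y, hu⟩
      obtain ⟨x, h⟩ := h2 u y
      exact ⟨x, h.2 hu⟩
  · simp only [hK, false_implies, not_false_iff, true_implies, true_and]
    constructor
    · intro h u y
      obtain ⟨x, h'⟩ := h2 u y
      exact h'.1 (h x)
    · intro h x
      obtain ⟨u, y, h'⟩ := h1 x
      exact h'.2 (h u y)

theorem toBC_win {n : ℕ} (d : Fin n) (V : CakeValuation) (C : Fin n → Prop)
    (Q : List (ℝ × ℝ × Fin n) → Prop)
    (hQ : ∀ L L', (∀ a, pieceValue V (allocOf L a) = pieceValue V (allocOf L' a)) → (Q L ↔ Q L'))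
    {m : ℕ} (T : ExtTree n m) : ∀ (m' : ℕ) (pos : Fin (m + 2) → Fin (m' + 2))
    (c0 : Fin (m' + 2) → ℝ), StrictMono c0 → c0 0 = 0 → c0 (Fin.last _) = 1 →
    (T.toG (c0 ∘ pos)).Win (fun _ => False) PartitionsCake →
    ∀ c : Fin (m' + 2) → ℝ, Monotone c → c 0 = 0 → c (Fin.last _) = 1 →
    ((T.toG (c ∘ pos)).Win C Q ↔ ((toBC d T m' pos).toG c).Win C Q) := by
  induction T with
  | leaf alloc =>
    intro m' pos c0 hc0 h00 h01 hval c hc h0 h1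
    exact hQ _ _ (fun a => leaf_value d alloc pos c0 hc0 h00 h01 hval c hc h0 h1 V a)
  | @cut m i a b child ih =>
    intro m' pos c0 hc0 h00 h01 hval c hc h0 h1
    rw [ExtTree.win_cut] at hval
    replace hval := hval.2 not_false
    have hcl : ∀ e : Fin (m' + 2) → ℝ, Monotone e →
        min ((e ∘ pos) a) ((e ∘ pos) b) = e (min (pos a) (pos b)) ∧
        max ((e ∘ pos) a) ((e ∘ pos) b) = e (max (pos a) (pos b)) :=
      fun e he => ⟨he.map_min.symm, he.map_max.symm⟩
    rw [ExtTree.win_cut]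
    simp only [(hcl c hc).1, (hcl c hc).2]
    simp only [(hcl c0 hc0.monotone).1, (hcl c0 hc0.monotone).2] at hval
    by_cases hab : pos a = pos b
    · have hself : ∀ u x : ℝ, clampR u u x = u := fun u x => by simp [clampR]
      simp only [hab, min_self, max_self, hself, extendPt_samePos] at hval ⊢
      simp only [exists_const, forall_const] at hval ⊢
      have := ih m' (samePos pos (pos b)) c0 hc0 h00 h01 hval c hc h0 h1
      simp only [toBC, hab, dif_pos]
      rw [← this]
      tauto
    · simp only [toBC, hab, dif_neg, not_false_iff]
      rw [BCTree.win_choose]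
      simp only [BCTree.win_cut]
      have hIH : ∀ t y, c (pieceIdx (pos a) (pos b) hab t).castSucc ≤ y →
          y ≤ c (pieceIdx (pos a) (pos b) hab t).succ →
          ((child.toG (extendPt (c ∘ pos) y)).Win C Q ↔
          ((toBC d child (m' + 1) (newPos pos (pieceIdx (pos a) (pos b) hab t))).toG
            (insertPt c (pieceIdx (pos a) (pos b) hab t) y)).Win C Q) := by
        intro t y hy1 hy2
        have hlo := pieceIdx_lo (pos a) (pos b) hab t
        have hhi := pieceIdx_hi (pos a) (pos b) hab t
        generalize pieceIdx (pos a) (pos b) hab t = j at *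
        rw [extendPt_newPos pos c j y]
        have hj : c0 j.castSucc < c0 j.succ := hc0 j.castSucc_lt_succ
        have hlo' := hc0.monotone hlo
        have hhi' := hc0.monotone hhi
        have hv := hval ((c0 j.castSucc + c0 j.succ) / 2)
        rw [clampR_of_mem (by linarith) (by linarith), extendPt_newPos pos c0 j] at hv
        refine ih (m' + 1) (newPos pos j) _ (insertPt_strictMono hc0 j (by linarith) (by linarith))
          ?_ ?_ hv _ (insertPt_monotone hc j hy1 hy2) ?_ ?_
        · rw [insertPt_zero, h00]
        · rw [insertPt_last, h01]
        · rw [insertPt_zero, h0]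
        · rw [insertPt_last, h1]
      apply quant_equiv
      · intro x
        have hle : c (min (pos a) (pos b)) ≤ c (max (pos a) (pos b)) := hc min_le_max
        obtain ⟨t, ht1, ht2⟩ := exists_piece c (pos a) (pos b) hab
          (clampR (c (min (pos a) (pos b))) (c (max (pos a) (pos b))) x) le_clampR (clampR_le hle)
        refine ⟨t, clampR (c (min (pos a) (pos b))) (c (max (pos a) (pos b))) x, ?_⟩
        rw [clampR_of_mem ht1 ht2]
        exact hIH t _ ht1 ht2
      · intro t y
        have hle := hc (pieceIdx (pos a) (pos b) hab t).castSucc_le_succ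
        have hlo := hc (pieceIdx_lo (pos a) (pos b) hab t)
        have hhi := hc (pieceIdx_hi (pos a) (pos b) hab t)
        have hy1 := @le_clampR (c (pieceIdx (pos a) (pos b) hab t).castSucc)
          (c (pieceIdx (pos a) (pos b) hab t).succ) y
        have hy2 := @clampR_le (c (pieceIdx (pos a) (pos b) hab t).castSucc)
          (c (pieceIdx (pos a) (pos b) hab t).succ) y hle
        refine ⟨clampR (c (pieceIdx (pos a) (pos b) hab t).castSucc)
          (c (pieceIdx (pos a) (pos b) hab t).succ) y, ?_⟩
        rw [clampR_of_mem (hlo.trans hy1) (hy2.trans hhi)]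
        exact hIH t _ hy1 hy2
  | choose i children ih =>
    intro m' pos c0 hc0 h00 h01 hval c hc h0 h1
    rw [ExtTree.win_choose] at hval
    replace hval := hval.2 not_false
    simp only [toBC]
    rw [ExtTree.win_choose, BCTree.win_choose]
    have := fun t => ih t m' pos c0 hc0 h00 h01 (hval t) c hc h0 h1
    simp only [this]

theorem agreeFrom_nil {s t : BCStrategy} : GTree.AgreeFrom [] s t ↔ s = t := by
  constructor
  · intro h
    cases s
    cases t
    congr 1
    · funext h'
      exact (h h' (List.nil_prefix)).1
    · funext h'
      exact (h h' (List.nil_prefix)).2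
  · rintro rfl h' _
    exact ⟨rfl, rfl⟩

theorem guarantees_iff {n : ℕ} (Str : List (ℝ × ℝ × Fin n) → Prop) (g : GTree n) (i : Fin n) :
    (∃ s : BCStrategy, ∀ σ : Fin n → BCStrategy, σ i = s → Str (g.play [] σ)) ↔
      g.Win (fun j => j = i) Str := by
  rw [← GTree.forces_iff_win _ _ _ []]
  simp only [agreeFrom_nil, forall_eq]
  constructor
  · rintro ⟨s, hs⟩
    exact ⟨fun _ => s, hs⟩
  · rintro ⟨τ, hτ⟩
    exact ⟨τ i, hτ⟩

theorem ExtProtocol.pos_agents {n : ℕ} (E : ExtProtocol n) : 0 < n := by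
  rcases Nat.eq_zero_or_pos n with rfl | h
  · exfalso
    obtain ⟨L', -, -, -, hh, -⟩ := E.valid (fun _ => ⟨fun _ => 0, fun _ => 0⟩)
    cases L' with
    | nil => simp at hh
    | cons q L => exact q.2.2.elim0
  · exact h

/-- **Theorem.** For every extended BC protocol there exists a BC protocol that is
strongly envy-equivalent to it. -/
theorem ext_bc_to_bc {n : ℕ} (E : ExtProtocol n) :
    ∃ B : BCTree n 0, StronglyEnvyEquiv E.toGame B.toGame := by
  have hn := E.pos_agents
  refine ⟨toBC ⟨0, hn⟩ E.tree 0 id, ?_⟩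
  intro i S _ M _ V
  have hmono : StrictMono initPts := by
    intro s t hst
    have : s = 0 ∧ t = 1 := by omega
    simp [initPts, this.1, this.2]
  have h0 : initPts 0 = 0 := by simp [initPts]
  have h1 : initPts (Fin.last _) = 1 := by simp [initPts]
  have hval : (E.tree.toG (initPts ∘ id)).Win (fun _ => False) PartitionsCake := by
    rw [← GTree.forces_iff_win _ _ _ []]
    refine ⟨fun _ => ⟨fun _ => 0, fun _ => 0⟩, fun σ _ => ?_⟩
    have := E.valid σ
    rwa [ExtTree.play_toG] at this
  have key := toBC_win ⟨0, hn⟩ V (fun j => j = i)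
    (fun L => ∀ j ∈ S, envy V (allocOf L) i j ≤ M j)
    (fun L L' h => by simp only [envy, h]) E.tree 0 id initPts hmono h0 h1 hval
    initPts hmono.monotone h0 h1
  rw [← guarantees_iff, ← guarantees_iff] at key
  simp only [← ExtTree.play_toG, ← BCTree.play_toG, Function.comp_id] at key
  exact key
end

section
/- Any extended BC protocol can be converted into a strongly envy-equivalent extended BC protocol in which no choose node of the tree representation has a cut node among its descendants; moreover, the resulting tree has exactly the same number of nodes as the original tree. -/
/-! ## Coalition game values -/

/-- The coalition `o` can force the outcome predicate `Q` from a given node. -/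
def ExtTree.Win {n : ℕ} (o : Fin n → Prop) (Q : List (ℝ × ℝ × Fin n) → Prop) :
    {m : ℕ} → ExtTree n m → (Fin (m + 2) → ℝ) → Prop
  | _, .leaf alloc, p => Q (alloc.map fun q => (p q.1, p q.2.1, q.2.2))
  | _, .cut i a b child, p =>
      (o i ∧ ∃ x : ℝ, child.Win o Q
        (extendPt p (max (min (p a) (p b)) (min x (max (p a) (p b)))))) ∨
      (¬ o i ∧ ∀ x : ℝ, child.Win o Q
        (extendPt p (max (min (p a) (p b)) (min x (max (p a) (p b))))))
  | _, .choose i children, p =>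
      (o i ∧ ∃ t, (children t).Win o Q p) ∨ (¬ o i ∧ ∀ t, (children t).Win o Q p)

theorem ExtTree.win_of_not_win {n m : ℕ} (T : ExtTree n m) (o : Fin n → Prop)
    (Q : List (ℝ × ℝ × Fin n) → Prop) (p : Fin (m + 2) → ℝ) (hw : ¬ T.Win o Q p) :
    T.Win (fun a => ¬ o a) (fun L => ¬ Q L) p := by
  induction T with
  | leaf alloc => exact hw
  | cut i a b child ih =>
    simp only [ExtTree.Win] at hw ⊢
    by_cases hi : o i
    · simp only [hi, true_and, not_true_eq_false, false_and, or_false, not_exists,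
        not_false_eq_true, false_or] at hw ⊢
      exact fun x => ih _ (hw x)
    · simp only [hi, true_and, not_true_eq_false, false_and, or_false, not_forall,
        not_false_eq_true, false_or] at hw ⊢
      obtain ⟨x, hx⟩ := hw
      exact ⟨x, ih _ hx⟩
  | choose i children ih =>
    simp only [ExtTree.Win] at hw ⊢
    by_cases hi : o i
    · simp only [hi, true_and, not_true_eq_false, false_and, or_false, not_exists,
        not_false_eq_true, false_or] at hw ⊢
      exact fun x => ih _ _ (hw x)
    · simp only [hi, true_and, not_true_eq_false, false_and, or_false, not_forall,
        not_false_eq_true, false_or] at hw ⊢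
      obtain ⟨x, hx⟩ := hw
      exact ⟨x, ih _ _ hx⟩

open Classical in
/-- Glue strategies for all possible next moves. -/
noncomputable def glueStrat {n : ℕ} (h : Hist) (c : ℝ) (t : ℕ)
    (F : ℝ ⊕ ℕ → Fin n → BCStrategy) (a : Fin n) : BCStrategy where
  cutAt := fun h' => match h'[h.length]? with
    | some x => (F x a).cutAt h'
    | none => c
  chooseAt := fun h' => match h'[h.length]? with
    | some x => (F x a).chooseAt h'
    | none => t

/-- Two strategies agree on all histories extending `h`. -/
def AgreeFrom (h : Hist) (s s' : BCStrategy) : Prop :=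
  ∀ h', h <+: h' → s.cutAt h' = s'.cutAt h' ∧ s.chooseAt h' = s'.chooseAt h'

theorem agree_glue {n : ℕ} (h : Hist) (c : ℝ) (t : ℕ)
    (F : ℝ ⊕ ℕ → Fin n → BCStrategy) (a : Fin n) (s : BCStrategy)
    (hs : AgreeFrom h s (glueStrat h c t F a)) (x : ℝ ⊕ ℕ) :
    AgreeFrom (h ++ [x]) s (F x a) := by
  rintro h' ⟨r, rfl⟩
  have := hs (h ++ [x] ++ r) ⟨[x] ++ r, by simp⟩
  simpa [glueStrat] using this

theorem agree_glue_self {n : ℕ} (h : Hist) (c : ℝ) (t : ℕ)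
    (F : ℝ ⊕ ℕ → Fin n → BCStrategy) (a : Fin n) (s : BCStrategy)
    (hs : AgreeFrom h s (glueStrat h c t F a)) : s.cutAt h = c ∧ s.chooseAt h = t := by
  simpa [glueStrat] using hs h ⟨[], by simp⟩

theorem ExtTree.strategy_of_win {n m : ℕ} (T : ExtTree n m) (o : Fin n → Prop)
    (Q : List (ℝ × ℝ × Fin n) → Prop) (p : Fin (m + 2) → ℝ) (hw : T.Win o Q p) (h : Hist) :
    ∃ σ : Fin n → BCStrategy, ∀ σ' : Fin n → BCStrategy,
      (∀ a, o a → AgreeFrom h (σ' a) (σ a)) → Q (T.playAlloc p h σ') := by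
  induction T generalizing h with
  | leaf alloc => exact ⟨fun _ => ⟨fun _ => 0, fun _ => 0⟩, fun σ' _ => hw⟩
  | cut i a b child ih =>
    have key : ∀ z : ℝ ⊕ ℕ, ∃ σ : Fin n → BCStrategy, ∀ y, z = Sum.inl y →
        child.Win o Q (extendPt p y) → ∀ σ' : Fin n → BCStrategy,
        (∀ a, o a → AgreeFrom (h ++ [z]) (σ' a) (σ a)) →
          Q (child.playAlloc (extendPt p y) (h ++ [z]) σ') := by
      intro z
      by_cases hz : ∃ y, z = Sum.inl y ∧ child.Win o Q (extendPt p y)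
      · obtain ⟨y, rfl, hy⟩ := hz
        obtain ⟨σ, hσ⟩ := ih _ hy (h ++ [Sum.inl y])
        refine ⟨σ, fun y' hyy _ => ?_⟩
        obtain rfl := Sum.inl.inj hyy
        exact hσ
      · exact ⟨fun _ => ⟨fun _ => 0, fun _ => 0⟩, fun y h1 h2 => (hz ⟨y, h1, h2⟩).elim⟩
    choose F hF using key
    rcases hw with ⟨hi, x, hx⟩ | ⟨hi, hx⟩
    · refine ⟨glueStrat h x 0 F, fun σ' hσ' => ?_⟩
      have h1 := (agree_glue_self h x 0 F i _ (hσ' i hi)).1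
      simp only [ExtTree.playAlloc, h1]
      exact hF _ _ rfl hx _ fun a ha => agree_glue h x 0 F a _ (hσ' a ha) _
    · refine ⟨glueStrat h 0 0 F, fun σ' hσ' => ?_⟩
      simp only [ExtTree.playAlloc]
      exact hF _ _ rfl (hx _) _ fun a ha => agree_glue h 0 0 F a _ (hσ' a ha) _
  | @choose m i k children ih =>
    have key : ∀ z : ℝ ⊕ ℕ, ∃ σ : Fin n → BCStrategy, ∀ t : Fin (k + 1), z = Sum.inr (t : ℕ) →
        (children t).Win o Q p → ∀ σ' : Fin n → BCStrategy,
        (∀ a, o a → AgreeFrom (h ++ [z]) (σ' a) (σ a)) →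
          Q ((children t).playAlloc p (h ++ [z]) σ') := by
      intro z
      by_cases hz : ∃ t : Fin (k + 1), z = Sum.inr (t : ℕ) ∧ (children t).Win o Q p
      · obtain ⟨y, rfl, hy⟩ := hz
        obtain ⟨σ, hσ⟩ := ih _ _ hy (h ++ [Sum.inr (y : ℕ)])
        refine ⟨σ, fun y' hyy _ => ?_⟩
        obtain rfl := Fin.ext (Sum.inr.inj hyy)
        exact hσ
      · exact ⟨fun _ => ⟨fun _ => 0, fun _ => 0⟩, fun y h1 h2 => (hz ⟨y, h1, h2⟩).elim⟩
    choose F hF using key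
    rcases hw with ⟨hi, x, hx⟩ | ⟨hi, hx⟩
    · refine ⟨glueStrat h 0 x F, fun σ' hσ' => ?_⟩
      have h1 := (agree_glue_self h 0 x F i _ (hσ' i hi)).2
      have h2 : (⟨(σ' i).chooseAt h % (k + 1), Nat.mod_lt _ (Nat.succ_pos k)⟩ : Fin (k + 1)) = x :=
        Fin.ext (by simp only [h1]; exact Nat.mod_eq_of_lt x.2)
      simp only [ExtTree.playAlloc]
      rw [h2, show (σ' i).chooseAt h % (k + 1) = (x : ℕ) from congrArg Fin.val h2]
      exact hF _ _ rfl hx _ fun a ha => agree_glue h 0 x F a _ (hσ' a ha) _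
    · refine ⟨glueStrat h 0 0 F, fun σ' hσ' => ?_⟩
      simp only [ExtTree.playAlloc]
      exact hF _ _ rfl (hx _) _ fun a ha => agree_glue h 0 0 F a _ (hσ' a ha) _

open Classical in
theorem ExtTree.win_iff {n m : ℕ} (T : ExtTree n m) (o : Fin n → Prop)
    (Q : List (ℝ × ℝ × Fin n) → Prop) (p : Fin (m + 2) → ℝ) (h : Hist) :
    T.Win o Q p ↔ ∃ σ : Fin n → BCStrategy, ∀ σ' : Fin n → BCStrategy,
      (∀ a, o a → σ' a = σ a) → Q (T.playAlloc p h σ') := by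
  constructor
  · intro hw
    obtain ⟨σ, hσ⟩ := T.strategy_of_win o Q p hw h
    refine ⟨σ, fun σ' hσ' => hσ σ' fun a ha => ?_⟩
    rw [hσ' a ha]
    exact fun _ _ => ⟨rfl, rfl⟩
  · rintro ⟨σ, hσ⟩
    by_contra hw
    obtain ⟨τ, hτ⟩ := T.strategy_of_win _ _ p (T.win_of_not_win o Q p hw) h
    refine hτ (fun a => if o a then σ a else τ a) (fun a ha => ?_) (hσ _ fun a ha => if_pos ha)
    rw [if_neg ha]
    exact fun _ _ => ⟨rfl, rfl⟩

/-! ## Renaming cut points -/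

/-- Extend a renaming of cut points by the newest cut point. -/
def extRen {m m' : ℕ} (ρ : Fin (m + 2) → Fin (m' + 2)) : Fin (m + 3) → Fin (m' + 3) :=
  fun t => if h : (t : ℕ) < m + 2 then (ρ ⟨t, h⟩).castSucc else Fin.last _

theorem extendPt_extRen {m m' : ℕ} (ρ : Fin (m + 2) → Fin (m' + 2)) (p : Fin (m' + 2) → ℝ)
    (y : ℝ) : extendPt p y ∘ extRen ρ = extendPt (p ∘ ρ) y := by
  funext t
  simp only [Function.comp, extendPt, extRen]
  by_cases h : (t : ℕ) < m + 2 <;> simp [h]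

theorem extendPt_castSucc {m : ℕ} (p : Fin (m + 2) → ℝ) (y : ℝ) :
    extendPt p y ∘ Fin.castSucc = p := by
  funext t
  simp [extendPt]

/-- Rename the cut points used by a tree. -/
def ExtTree.ren {n : ℕ} : {m m' : ℕ} → ExtTree n m → (Fin (m + 2) → Fin (m' + 2)) → ExtTree n m'
  | _, _, .leaf alloc, ρ => .leaf (alloc.map fun q => (ρ q.1, ρ q.2.1, q.2.2))
  | _, _, .cut i a b child, ρ => .cut i (ρ a) (ρ b) (child.ren (extRen ρ))
  | _, _, .choose i children, ρ => .choose i fun t => (children t).ren ρ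

theorem ExtTree.size_ren {n m m' : ℕ} (T : ExtTree n m) (ρ : Fin (m + 2) → Fin (m' + 2)) :
    (T.ren ρ).size = T.size := by
  induction T generalizing m' with
  | leaf alloc => rfl
  | cut i a b child ih => simp [ExtTree.ren, ExtTree.size, ih]
  | choose i children ih => simp [ExtTree.ren, ExtTree.size, ih]

theorem ExtTree.win_ren {n m m' : ℕ} (T : ExtTree n m) (ρ : Fin (m + 2) → Fin (m' + 2))
    (o : Fin n → Prop) (Q : List (ℝ × ℝ × Fin n) → Prop) (p : Fin (m' + 2) → ℝ) :
    (T.ren ρ).Win o Q p ↔ T.Win o Q (p ∘ ρ) := by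
  induction T generalizing m' with
  | leaf alloc => simp [ExtTree.ren, ExtTree.Win, Function.comp_def]
  | cut i a b child ih =>
    simp only [ExtTree.ren, ExtTree.Win, ih, extendPt_extRen, Function.comp]
  | choose i children ih => simp only [ExtTree.ren, ExtTree.Win, ih]

/-! ## The transformation -/

theorem ExtTree.transform {n : ℕ} (N : ℕ) : ∀ {m : ℕ} (T : ExtTree n m), T.size = N →
    ∃ T' : ExtTree n m, T'.cutsBeforeChoices ∧ T'.size = T.size ∧
      ∀ o Q p, T.Win o Q p ↔ T'.Win o Q p := by
  induction N using Nat.strong_induction_on with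
  | _ N IH =>
  intro m T hT
  cases T with
  | leaf alloc => exact ⟨.leaf alloc, trivial, rfl, fun _ _ _ => Iff.rfl⟩
  | cut i a b child =>
    simp only [ExtTree.size] at hT
    obtain ⟨C, h1, h2, h3⟩ := IH _ (by omega) child rfl
    refine ⟨.cut i a b C, h1, by simp [ExtTree.size, h2], fun o Q p => ?_⟩
    simp only [ExtTree.Win, h3]
  | @choose _ i k children =>
    simp only [ExtTree.size] at hT
    have hlt : ∀ t, (children t).size < N := fun t => by
      have := Finset.single_le_sum (f := fun t => (children t).size)
        (fun _ _ => Nat.zero_le _) (Finset.mem_univ t)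
      omega
    choose C h1 h2 h3 using fun t => IH _ (hlt t) (children t) rfl
    by_cases hc : ∃ t, (C t).hasCut
    · obtain ⟨t, ht⟩ := hc
      obtain ⟨j, a, b, D, hD⟩ : ∃ j a b D, C t = .cut j a b D := by
        have h1t := h1 t
        generalize C t = X at ht h1t
        cases X with
        | leaf alloc => exact ht.elim
        | cut j a b D => exact ⟨j, a, b, D, rfl⟩
        | choose i' ch =>
          obtain ⟨u, hu⟩ := ht
          exact (h1t u hu).elim
      let G : Fin (k + 1) → ExtTree n (m + 1) :=
        Function.update (fun u => (C u).ren Fin.castSucc) t D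
      have hGt : G t = D := by simp [G]
      have hGu : ∀ u, u ≠ t → G u = (C u).ren Fin.castSucc := fun u hu => by simp [G, hu]
      have hsum : (∑ u, (G u).size) + 1 = ∑ u, (children u).size := by
        rw [← Finset.add_sum_erase _ _ (Finset.mem_univ t),
          ← Finset.add_sum_erase _ (fun u => (children u).size) (Finset.mem_univ t), hGt,
          ← h2 t, hD, Finset.sum_congr rfl (g := fun u => (children u).size)]
        · simp only [ExtTree.size]; omega
        · intro u hu
          rw [hGu u (Finset.ne_of_mem_erase hu), ExtTree.size_ren, h2]
      obtain ⟨R, r1, r2, r3⟩ := IH ((∑ u, (G u).size) + 1) (by omega) (.choose i G) rfl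
      refine ⟨.cut j a b R, r1, ?_, fun o Q p => ?_⟩
      · simp only [ExtTree.size, r2]; omega
      · have hGw : ∀ u, u ≠ t → ∀ y, (G u).Win o Q (extendPt p y) ↔ (C u).Win o Q p := by
          intro u hu y
          rw [hGu u hu, ExtTree.win_ren, extendPt_castSucc]
        have hCt : (C t).Win o Q p ↔ (ExtTree.cut j a b D).Win o Q p := by rw [hD]
        simp only [ExtTree.Win] at hCt
        simp only [ExtTree.Win, h3, ← r3]
        rw [← hGt] at hCt
        generalize hy : (fun x : ℝ => max (min (p a) (p b)) (min x (max (p a) (p b)))) = f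
        have hf : ∀ x, max (min (p a) (p b)) (min x (max (p a) (p b))) = f x :=
          fun x => by rw [← hy]
        simp only [hf] at hCt ⊢
        have hA : ∀ x, (∃ u, (G u).Win o Q (extendPt p (f x))) ↔
            ((∃ u, u ≠ t ∧ (C u).Win o Q p) ∨ (G t).Win o Q (extendPt p (f x))) := by
          intro x
          constructor
          · rintro ⟨u, hu⟩
            by_cases hut : u = t
            · subst hut; exact Or.inr hu
            · exact Or.inl ⟨u, hut, (hGw u hut _).1 hu⟩
          · rintro (⟨u, hut, hu⟩ | hu)
            · exact ⟨u, (hGw u hut _).2 hu⟩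
            · exact ⟨t, hu⟩
        have hB : ∀ x, (∀ u, (G u).Win o Q (extendPt p (f x))) ↔
            ((∀ u, u ≠ t → (C u).Win o Q p) ∧ (G t).Win o Q (extendPt p (f x))) := by
          intro x
          constructor
          · intro hu
            exact ⟨fun u hut => (hGw u hut _).1 (hu u), hu t⟩
          · rintro ⟨hu, h'⟩ u
            by_cases hut : u = t
            · subst hut; exact h'
            · exact (hGw u hut _).2 (hu u hut)
        have hA' : (∃ u, (C u).Win o Q p) ↔
            ((∃ u, u ≠ t ∧ (C u).Win o Q p) ∨ (C t).Win o Q p) := by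
          constructor
          · rintro ⟨u, hu⟩
            by_cases hut : u = t
            · subst hut; exact Or.inr hu
            · exact Or.inl ⟨u, hut, hu⟩
          · rintro (⟨u, -, hu⟩ | hu)
            · exact ⟨u, hu⟩
            · exact ⟨t, hu⟩
        have hB' : (∀ u, (C u).Win o Q p) ↔
            ((∀ u, u ≠ t → (C u).Win o Q p) ∧ (C t).Win o Q p) := by
          constructor
          · intro hu
            exact ⟨fun u _ => hu u, hu t⟩
          · rintro ⟨hu, h'⟩ u
            by_cases hut : u = t
            · subst hut; exact h'
            · exact hu u hut
        simp only [hA, hB]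
        rw [hA', hB', hCt]
        by_cases hi : o i <;> by_cases hj : o j <;>
          simp only [hi, hj, true_and, not_true_eq_false, false_and, or_false,
            not_false_eq_true, false_or, exists_or, exists_and_left, forall_or_left,
            forall_and, exists_const, forall_const]
    · push Not at hc
      refine ⟨.choose i C, hc, by simp [ExtTree.size, h2], fun o Q p => ?_⟩
      simp only [ExtTree.Win, h3]

theorem ExtProtocol.guarantees_iff {n : ℕ} (E : ExtProtocol n) (i : Fin n) (S : Finset (Fin n))
    (M : Fin n → ℝ) (V : CakeValuation) :
    Guarantees E.toGame i S M V ↔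
      E.tree.Win (fun a => a = i) (fun L => ∀ j ∈ S, envy V (allocOf L) i j ≤ M j) initPts := by
  rw [ExtTree.win_iff _ _ _ _ []]
  constructor
  · rintro ⟨s, hs⟩
    exact ⟨fun _ => s, fun σ' h => hs σ' (h i rfl)⟩
  · rintro ⟨σ, hσ⟩
    refine ⟨σ i, fun σ' h => hσ σ' ?_⟩
    rintro a rfl
    exact h

/-- **Theorem.** Any extended BC protocol can be converted into a strongly
envy-equivalent extended BC protocol in which no choose node of the tree
representation has a cut node among its descendants; moreover, the resulting tree has
exactly the same number of nodes as the original tree. -/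
theorem ext_cuts_before_choices {n : ℕ} (E : ExtProtocol n) :
    ∃ E' : ExtProtocol n,
      E'.tree.cutsBeforeChoices ∧
      E'.tree.size = E.tree.size ∧
      StronglyEnvyEquiv E.toGame E'.toGame := by
  obtain ⟨T, h1, h2, h3⟩ := E.tree.transform _ rfl
  have hv : ∀ σ : Fin n → BCStrategy, PartitionsCake (T.playAlloc initPts [] σ) := by
    have hw : E.tree.Win (fun _ => False) PartitionsCake initPts :=
      (E.tree.win_iff _ _ _ []).2
        ⟨fun _ => ⟨fun _ => 0, fun _ => 0⟩, fun σ _ => E.valid σ⟩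
    rw [h3, T.win_iff _ _ _ []] at hw
    obtain ⟨_, hσ⟩ := hw
    exact fun σ => hσ σ fun _ h => h.elim
  refine ⟨⟨T, hv⟩, h1, h2, fun i S _ M _ V => ?_⟩
  rw [ExtProtocol.guarantees_iff, ExtProtocol.guarantees_iff, h3]
end

section
/- Any BC protocol can be converted into a strongly envy-equivalent BC protocol in which no choose node of the tree representation has a cut node among its descendants (so along every root-to-leaf path, all cut nodes precede all choose nodes). -/
/-- A BC tree contains a cut node. -/
def BCTree.hasCut {n : ℕ} : {m : ℕ} → BCTree n m → Prop
  | _, .leaf _ => False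
  | _, .cut _ _ _ => True
  | _, @BCTree.choose _ _ _ _ children => ∃ t, (children t).hasCut

/-- No choose node of the tree has a cut node among its descendants. -/
def BCTree.cutsBeforeChoices {n : ℕ} : {m : ℕ} → BCTree n m → Prop
  | _, .leaf _ => True
  | _, .cut _ _ child => child.cutsBeforeChoices
  | _, @BCTree.choose _ _ _ _ children => ∀ t, ¬ (children t).hasCut

def BCTree.intermediateForm {n : ℕ} : {m : ℕ} → BCTree n m → Prop
  | _, .leaf _ => True
  | _, .cut _ _ child => child.intermediateForm
  | m, @BCTree.choose _ _ i k children =>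
      (∀ t, (children t).intermediateForm) ∧
      ((∀ t, ¬ (children t).hasCut) ∨
        ∃ j0 : ℕ, ∀ t : Fin (k + 1), ∃ (j : Fin (m + 1)) (c : BCTree n (m + 1)),
          children t = BCTree.cut i j c ∧ (j : ℕ) = j0 + (t : ℕ))

namespace BCProof

/-- Points of a partition are sorted and lie in `[0,1]`. -/
def Valid {m : ℕ} (c : Fin (m + 2) → ℝ) : Prop :=
  Monotone c ∧ 0 ≤ c 0 ∧ c (Fin.last _) ≤ 1

structure Goal (n : ℕ) where
  i : Fin n
  S : Finset (Fin n)
  M : Fin n → ℝ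
  V : CakeValuation

def Goal.ok {n : ℕ} (G : Goal n) (L : List (ℝ × ℝ × Fin n)) : Prop :=
  ∀ j ∈ G.S, envy G.V (allocOf L) G.i j ≤ G.M j

/-- The position is winning for the agent `G.i` against the coalition of the others. -/
def win {n : ℕ} (G : Goal n) : {m : ℕ} → BCTree n m → (Fin (m + 2) → ℝ) → Prop
  | m, .leaf alloc, c =>
      G.ok ((List.finRange (m + 1)).map fun t => (c t.castSucc, c t.succ, alloc t))
  | _, .cut a j child, c =>
      if a = G.i then ∃ y, c j.castSucc ≤ y ∧ y ≤ c j.succ ∧ win G child (insertPt c j y)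
      else ∀ y, c j.castSucc ≤ y → y ≤ c j.succ → win G child (insertPt c j y)
  | _, @BCTree.choose _ _ a _ children, c =>
      if a = G.i then ∃ t, win G (children t) c else ∀ t, win G (children t) c

/-! ### Points -/

theorem insertPt_le {m : ℕ} (c : Fin (m + 2) → ℝ) (j : Fin (m + 1)) (y : ℝ) (t : Fin (m + 3))
    (s : Fin (m + 2)) (h : (t : ℕ) ≤ j) (hs : (s : ℕ) = t) : insertPt c j y t = c s := by
  unfold insertPt
  rw [dif_pos h]
  congr 1
  ext; simp [hs]

theorem insertPt_eq {m : ℕ} (c : Fin (m + 2) → ℝ) (j : Fin (m + 1)) (y : ℝ) (t : Fin (m + 3))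
    (h : (t : ℕ) = j + 1) : insertPt c j y t = y := by
  unfold insertPt
  rw [dif_neg (by omega), if_pos h]

theorem insertPt_gt {m : ℕ} (c : Fin (m + 2) → ℝ) (j : Fin (m + 1)) (y : ℝ) (t : Fin (m + 3))
    (s : Fin (m + 2)) (h : (j : ℕ) + 1 < t) (hs : (s : ℕ) + 1 = t) :
    insertPt c j y t = c s := by
  unfold insertPt
  rw [dif_neg (by omega), if_neg (by omega)]
  congr 1
  ext; simp; omega

theorem Valid.le {m : ℕ} {c : Fin (m + 2) → ℝ} (h : Valid c) (j : Fin (m + 1)) :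
    c j.castSucc ≤ c j.succ := h.1 (by rw [Fin.le_def]; simp)

theorem Valid.nonneg {m : ℕ} {c : Fin (m + 2) → ℝ} (h : Valid c) (j : Fin (m + 2)) :
    0 ≤ c j := h.2.1.trans (h.1 (Fin.zero_le _))

theorem Valid.le_one {m : ℕ} {c : Fin (m + 2) → ℝ} (h : Valid c) (j : Fin (m + 2)) :
    c j ≤ 1 := (h.1 (Fin.le_last _)).trans h.2.2

theorem Valid.insertPt {m : ℕ} {c : Fin (m + 2) → ℝ} (h : Valid c) (j : Fin (m + 1)) {y : ℝ}
    (h1 : c j.castSucc ≤ y) (h2 : y ≤ c j.succ) : Valid (insertPt c j y) := by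
  have hj := j.isLt
  refine ⟨?_, ?_, ?_⟩
  · rw [Fin.monotone_iff_le_succ]
    intro t
    have ht := t.isLt
    rcases lt_trichotomy (t : ℕ) j with hlt | heq | hgt
    · rw [insertPt_le c j y t.castSucc ⟨t, by omega⟩ (by simp; omega) (by simp),
        insertPt_le c j y t.succ ⟨t + 1, by omega⟩ (by simp; omega) (by simp)]
      exact h.1 (by rw [Fin.le_def]; simp)
    · rw [insertPt_le c j y t.castSucc j.castSucc (by simp; omega) (by simp; omega),
        insertPt_eq c j y t.succ (by simp; omega)]
      exact h1
    · rw [insertPt_gt c j y t.succ ⟨t, by omega⟩ (by simp; omega) (by simp)]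
      by_cases h3 : (t : ℕ) = j + 1
      · rw [insertPt_eq c j y t.castSucc (by simp; omega)]
        refine h2.trans (h.1 ?_)
        rw [Fin.le_def]; simp; omega
      · rw [insertPt_gt c j y t.castSucc ⟨t - 1, by omega⟩ (by simp; omega) (by simp; omega)]
        exact h.1 (by rw [Fin.le_def]; simp)
  · rw [insertPt_le c j y 0 0 (by simp) (by simp)]
    exact h.2.1
  · rw [insertPt_gt c j y (Fin.last _) (Fin.last _) (by simp; omega) (by simp)]
    exact h.2.2

/-! ### Guarantees is the same as winning -/

theorem play_congr {n : ℕ} {m : ℕ} (T : BCTree n m) : ∀ (c : Fin (m + 2) → ℝ) (h : Hist)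
    (σ σ' : Fin n → BCStrategy),
    (∀ a l, (σ a).cutAt (h ++ l) = (σ' a).cutAt (h ++ l)) →
    (∀ a l, (σ a).chooseAt (h ++ l) = (σ' a).chooseAt (h ++ l)) →
    T.playAlloc c h σ = T.playAlloc c h σ' := by
  induction T with
  | leaf alloc => intros; rfl
  | cut a j child ih =>
    intro c h σ σ' h1 h2
    have := h1 a []
    simp only [List.append_nil] at this
    simp only [BCTree.playAlloc, this]
    apply ih
    · intro b l; rw [List.append_assoc]; exact h1 _ _
    · intro b l; rw [List.append_assoc]; exact h2 _ _
  | choose a children ih =>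
    intro c h σ σ' h1 h2
    have := h2 a []
    simp only [List.append_nil] at this
    simp only [BCTree.playAlloc, this]
    apply ih
    · intro b l; rw [List.append_assoc]; exact h1 _ _
    · intro b l; rw [List.append_assoc]; exact h2 _ _

/-- Combine a strategy at `h` with strategies for the continuations of `h`. -/
def combine (h : Hist) (s0 : BCStrategy) (s : ℝ ⊕ ℕ → BCStrategy) : BCStrategy where
  cutAt := fun g => match g[h.length]? with
    | none => s0.cutAt g
    | some e => (s e).cutAt g
  chooseAt := fun g => match g[h.length]? with
    | none => s0.chooseAt g
    | some e => (s e).chooseAt g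

theorem combine_cut (h : Hist) (s0 s) : (combine h s0 s).cutAt h = s0.cutAt h := by
  simp [combine]

theorem combine_choose (h : Hist) (s0 s) : (combine h s0 s).chooseAt h = s0.chooseAt h := by
  simp [combine]

theorem combine_cut' (h : Hist) (s0 s e l) :
    (combine h s0 s).cutAt (h ++ [e] ++ l) = (s e).cutAt (h ++ [e] ++ l) := by
  simp [combine]

theorem combine_choose' (h : Hist) (s0 s e l) :
    (combine h s0 s).chooseAt (h ++ [e] ++ l) = (s e).chooseAt (h ++ [e] ++ l) := by
  simp [combine]

/-- Playing against `combine` in a continuation is playing against the component. -/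
theorem play_combine {n m : ℕ} (T : BCTree n m) (c h σ) (a : Fin n) (s0 s) (e)
    (hσ : σ a = combine h s0 s) :
    T.playAlloc c (h ++ [e]) σ = T.playAlloc c (h ++ [e]) (Function.update σ a (s e)) := by
  apply play_congr
  · intro b l
    by_cases hb : b = a
    · subst hb; rw [hσ, combine_cut']; simp
    · simp [hb]
  · intro b l
    by_cases hb : b = a
    · subst hb; rw [hσ, combine_choose']; simp
    · simp [hb]

theorem guar_iff {n : ℕ} (G : Goal n) {m : ℕ} (T : BCTree n m) :
    ∀ (c : Fin (m + 2) → ℝ) (h : Hist), Valid c →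
    ((∃ s : BCStrategy, ∀ σ : Fin n → BCStrategy, σ G.i = s → G.ok (T.playAlloc c h σ)) ↔
      win G T c) := by
  induction T with
  | leaf alloc =>
    intro c h hc
    simp only [BCTree.playAlloc, win]
    constructor
    · rintro ⟨s, hs⟩; exact hs (fun _ => s) rfl
    · intro h; exact ⟨⟨fun _ => 0, fun _ => 0⟩, fun _ _ => h⟩
  | cut a j child ih =>
    intro c h hc
    simp only [BCTree.playAlloc, win]
    have clamp : ∀ y, c j.castSucc ≤ y → y ≤ c j.succ →
        max (c j.castSucc) (min y (c j.succ)) = y := by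
      intro y h1 h2; rw [min_eq_left h2, max_eq_right h1]
    by_cases ha : a = G.i
    · rw [if_pos ha]
      constructor
      · rintro ⟨s, hs⟩
        refine ⟨max (c j.castSucc) (min (s.cutAt h) (c j.succ)), le_max_left _ _,
          max_le (hc.le j) (min_le_right _ _), ?_⟩
        rw [← ih _ (h ++ [Sum.inl (max (c j.castSucc) (min (s.cutAt h) (c j.succ)))])
          (hc.insertPt j (le_max_left _ _) (max_le (hc.le j) (min_le_right _ _)))]
        refine ⟨s, fun σ hσ => ?_⟩
        have := hs σ hσ
        rwa [ha, hσ] at this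
      · rintro ⟨y, h1, h2, hw⟩
        rw [← ih _ (h ++ [Sum.inl y]) (hc.insertPt j h1 h2)] at hw
        obtain ⟨s, hs⟩ := hw
        refine ⟨combine h ⟨fun _ => y, fun _ => 0⟩ (fun _ => s), fun σ hσ => ?_⟩
        rw [ha, hσ, combine_cut, clamp y h1 h2, play_combine _ _ _ _ _ _ _ _ hσ]
        exact hs _ (by simp)
    · rw [if_neg ha]
      constructor
      · rintro ⟨s, hs⟩ y h1 h2
        rw [← ih _ (h ++ [Sum.inl y]) (hc.insertPt j h1 h2)]
        refine ⟨s, fun σ hσ => ?_⟩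
        have := hs (Function.update σ a (combine h ⟨fun _ => y, fun _ => 0⟩ (fun _ => σ a)))
          (by rw [Function.update_of_ne (Ne.symm ha)]; exact hσ)
        simp only [Function.update_self, combine_cut, clamp y h1 h2] at this
        rw [play_combine _ _ _ _ a _ _ _ (by rw [Function.update_self])] at this
        simpa using this
      · intro hw
        have : ∀ y, ∃ s : BCStrategy, c j.castSucc ≤ y → y ≤ c j.succ →
            ∀ σ : Fin n → BCStrategy, σ G.i = s →
              G.ok (child.playAlloc (insertPt c j y) (h ++ [Sum.inl y]) σ) := by
          intro y
          by_cases hy : c j.castSucc ≤ y ∧ y ≤ c j.succ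
          · obtain ⟨s, hs⟩ := (ih _ (h ++ [Sum.inl y]) (hc.insertPt j hy.1 hy.2)).2
              (hw y hy.1 hy.2)
            exact ⟨s, fun _ _ => hs⟩
          · exact ⟨⟨fun _ => 0, fun _ => 0⟩, fun h1 h2 => absurd ⟨h1, h2⟩ hy⟩
        choose s hs using this
        refine ⟨combine h ⟨fun _ => 0, fun _ => 0⟩
          (Sum.elim s (fun _ => ⟨fun _ => 0, fun _ => 0⟩)), fun σ hσ => ?_⟩
        rw [play_combine _ _ _ _ _ _ _ _ hσ]
        exact hs _ (le_max_left _ _) (max_le (hc.le j) (min_le_right _ _)) _ (by simp)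
  | @choose m a k children ih =>
    intro c h hc
    simp only [BCTree.playAlloc, win]
    by_cases ha : a = G.i
    · rw [if_pos ha]
      constructor
      · rintro ⟨s, hs⟩
        refine ⟨⟨s.chooseAt h % (k + 1), Nat.mod_lt _ (Nat.succ_pos k)⟩, ?_⟩
        rw [← ih _ _ (h ++ [Sum.inr (s.chooseAt h % (k + 1))]) hc]
        refine ⟨s, fun σ hσ => ?_⟩
        subst hσ
        subst ha
        exact hs σ rfl
      · rintro ⟨t, hw⟩
        rw [← ih _ _ (h ++ [Sum.inr (t : ℕ)]) hc] at hw
        obtain ⟨s, hs⟩ := hw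
        refine ⟨combine h ⟨fun _ => 0, fun _ => t⟩ (fun _ => s), fun σ hσ => ?_⟩
        have e : (σ a).chooseAt h = t := by rw [ha, hσ, combine_choose]
        have e' : (t : ℕ) % (k + 1) = t := Nat.mod_eq_of_lt t.isLt
        simp only [e, e']
        rw [play_combine _ _ _ _ _ _ _ _ hσ]
        exact hs _ (by simp)
    · rw [if_neg ha]
      constructor
      · rintro ⟨s, hs⟩ t
        rw [← ih _ _ (h ++ [Sum.inr (t : ℕ)]) hc]
        refine ⟨s, fun σ hσ => ?_⟩
        have := hs (Function.update σ a (combine h ⟨fun _ => 0, fun _ => t⟩ (fun _ => σ a)))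
          (by rw [Function.update_of_ne (Ne.symm ha)]; exact hσ)
        simp only [Function.update_self, combine_choose, Nat.mod_eq_of_lt t.isLt] at this
        rw [play_combine _ _ _ _ a _ _ _ (by rw [Function.update_self])] at this
        simpa using this
      · intro hw
        have : ∀ t : ℕ, ∃ s : BCStrategy, ∀ ht : t < k + 1,
            ∀ σ : Fin n → BCStrategy, σ G.i = s →
              G.ok ((children ⟨t, ht⟩).playAlloc c (h ++ [Sum.inr t]) σ) := by
          intro t
          by_cases ht : t < k + 1
          · obtain ⟨s, hs⟩ := (ih ⟨t, ht⟩ _ (h ++ [Sum.inr t]) hc).2 (hw _)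
            exact ⟨s, fun _ => hs⟩
          · exact ⟨⟨fun _ => 0, fun _ => 0⟩, fun h1 => absurd h1 ht⟩
        choose s hs using this
        refine ⟨combine h ⟨fun _ => 0, fun _ => 0⟩
          (Sum.elim (fun _ => ⟨fun _ => 0, fun _ => 0⟩) s), fun σ hσ => ?_⟩
        rw [play_combine _ _ _ _ _ _ _ _ hσ]
        exact hs _ (Nat.mod_lt _ (Nat.succ_pos k)) _ (by simp)

/-! ### Grid refinements -/

structure Grid (m M : ℕ) where
  f : Fin (m + 2) → Fin (M + 2)
  mono : StrictMono f
  zero : f 0 = 0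
  last : f (Fin.last _) = Fin.last _

def Grid.id (m : ℕ) : Grid m m := ⟨fun t => t, strictMono_id, rfl, rfl⟩

def Grid.comp {m M N : ℕ} (φ : Grid m M) (ψ : Grid M N) : Grid m N :=
  ⟨fun t => ψ.f (φ.f t), ψ.mono.comp φ.mono, by rw [φ.zero, ψ.zero], by rw [φ.last, ψ.last]⟩

theorem Valid.grid {m M : ℕ} {f : Fin (M + 2) → ℝ} (h : Valid f) (φ : Grid m M) :
    Valid (f ∘ φ.f) := by
  refine ⟨h.1.comp φ.mono.monotone, ?_, ?_⟩
  · simp only [Function.comp, φ.zero]; exact h.2.1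
  · simp only [Function.comp, φ.last]; exact h.2.2

def insIdx {m M : ℕ} (φ : Fin (m + 2) → Fin (M + 2)) (j : Fin (m + 1)) (p : Fin (M + 1)) :
    Fin (m + 3) → Fin (M + 3) := fun t =>
  if h1 : (t : ℕ) ≤ (j : ℕ) then (φ ⟨t, by have := j.isLt; omega⟩).castSucc
  else if (t : ℕ) = (j : ℕ) + 1 then p.castSucc.succ
  else (φ ⟨(t : ℕ) - 1, by have := t.isLt; omega⟩).succ

def skip {M : ℕ} (p : Fin (M + 1)) : Grid M (M + 1) where
  f := fun t => if (t : ℕ) ≤ p then t.castSucc else t.succ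
  mono := by
    intro s t hst
    rw [Fin.lt_def] at hst ⊢
    dsimp only
    split_ifs <;> simp <;> omega
  zero := by simp
  last := by
    have := p.isLt
    rw [if_neg (by simp; omega)]; rfl

theorem insertPt_skip {M : ℕ} (f : Fin (M + 2) → ℝ) (p : Fin (M + 1)) (y : ℝ) :
    insertPt f p y ∘ (skip p).f = f := by
  funext t
  simp only [Function.comp, skip]
  split_ifs with h
  · exact insertPt_le _ _ _ _ _ (by simpa using h) (by simp)
  · exact insertPt_gt _ _ _ _ _ (by simp; omega) (by simp)

def ins {m M : ℕ} (φ : Grid m M) (j : Fin (m + 1)) (p : Fin (M + 1))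
    (h1 : φ.f j.castSucc ≤ p.castSucc) (h2 : p.castSucc < φ.f j.succ) :
    Grid (m + 1) (M + 1) where
  f := insIdx φ.f j p
  mono := by
    have hj := j.isLt
    rw [Fin.le_def] at h1
    rw [Fin.lt_def] at h2
    rw [Fin.strictMono_iff_lt_succ]
    intro t
    have ht := t.isLt
    rw [Fin.lt_def]
    rcases lt_trichotomy (t : ℕ) j with hlt | heq | hgt
    · have := φ.mono (show (⟨t, by omega⟩ : Fin (m + 2)) < ⟨t + 1, by omega⟩ by
        rw [Fin.lt_def]; simp)
      rw [Fin.lt_def] at this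
      simp only [insIdx, Fin.val_castSucc, Fin.val_succ]
      rw [dif_pos (by omega), dif_pos (by omega)]
      exact this
    · have : (⟨t, by omega⟩ : Fin (m + 2)) = j.castSucc := by ext; simp [heq]
      simp only [insIdx, Fin.val_castSucc, Fin.val_succ]
      rw [dif_pos (by omega), dif_neg (by omega), if_pos (by omega), this]
      simp at h1 ⊢
      omega
    · simp only [insIdx, Fin.val_castSucc, Fin.val_succ]
      by_cases h3 : (t : ℕ) = j + 1
      · have : (⟨t + 1 - 1, by omega⟩ : Fin (m + 2)) = j.succ := by ext; simp [h3]
        rw [dif_neg (by omega), if_pos (by omega), dif_neg (by omega), if_neg (by omega), this]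
        simp at h2 ⊢
        omega
      · have := φ.mono (show (⟨t - 1, by omega⟩ : Fin (m + 2)) < ⟨t + 1 - 1, by omega⟩ by
          show (t : ℕ) - 1 < (t : ℕ) + 1 - 1
          omega)
        rw [Fin.lt_def] at this
        rw [dif_neg (by omega), if_neg (by omega), dif_neg (by omega), if_neg (by omega)]
        simpa using this
  zero := by
    simp [insIdx, φ.zero]
  last := by
    have hj := j.isLt
    have : (⟨m + 1, by omega⟩ : Fin (m + 2)) = Fin.last _ := rfl
    simp only [insIdx, Fin.val_last]
    rw [dif_neg (by omega), if_neg (by omega)]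
    simp only [Nat.add_sub_cancel, this, φ.last]
    rfl

theorem insertPt_ins {m M : ℕ} (φ : Grid m M) (j : Fin (m + 1)) (p : Fin (M + 1)) (h1) (h2)
    (f : Fin (M + 2) → ℝ) (y : ℝ) :
    insertPt f p y ∘ (ins φ j p h1 h2).f = insertPt (f ∘ φ.f) j y := by
  funext t
  have hj := j.isLt
  have ht := t.isLt
  rw [Fin.le_def] at h1
  rw [Fin.lt_def] at h2
  simp only [Fin.val_castSucc] at h1 h2
  simp only [Function.comp, ins, insIdx]
  split_ifs with h3 h4
  · rw [insertPt_le (f ∘ φ.f) j y t ⟨t, by omega⟩ h3 rfl]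
    apply insertPt_le
    · have := φ.mono.monotone (show (⟨t, by omega⟩ : Fin (m + 2)) ≤ j.castSucc by
        rw [Fin.le_def]; simpa using h3)
      rw [Fin.le_def] at this
      simp only [Fin.val_castSucc] at this ⊢
      omega
    · simp
  · rw [insertPt_eq (f ∘ φ.f) j y t h4]
    exact insertPt_eq _ _ _ _ (by simp)
  · rw [insertPt_gt (f ∘ φ.f) j y t ⟨t - 1, by omega⟩ (by omega) (by simp; omega)]
    apply insertPt_gt
    · have := φ.mono.monotone (show j.succ ≤ (⟨t - 1, by omega⟩ : Fin (m + 2)) by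
        rw [Fin.le_def]; simp; omega)
      rw [Fin.le_def] at this
      simp only [Fin.val_succ]
      omega
    · simp

/-! ### Refining leaves -/

theorem pieceValue_alloc {n m : ℕ} (V : CakeValuation) (alloc : Fin (m + 1) → Fin n)
    (c : Fin (m + 2) → ℝ) (a : Fin n) :
    pieceValue V (allocOf ((List.finRange (m + 1)).map
      fun t => (c t.castSucc, c t.succ, alloc t)) a) =
    ∑ t : Fin (m + 1), if alloc t = a then V.v (c t.castSucc) (c t.succ) else 0 := by
  rw [← List.sum_ofFn, List.ofFn_eq_map]
  unfold pieceValue allocOf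
  generalize List.finRange (m + 1) = L
  induction L with
  | nil => simp
  | cons x L ih =>
    simp only [List.map_cons, List.filter_cons, List.sum_cons]
    by_cases h : alloc x = a
    · simp [h] at ih ⊢; exact ih
    · simp [h] at ih ⊢; exact ih

theorem v_eq (V : CakeValuation) {a b : ℝ} (h0 : 0 ≤ a) (h1 : a ≤ b) (h2 : b ≤ 1) :
    V.v a b = V.v 0 b - V.v 0 a := by
  have := V.additive 0 a b le_rfl h0 h1 h2
  linarith

theorem exists_block {m M : ℕ} (φ : Grid m M) (p : Fin (M + 1)) :
    ∃ t : Fin (m + 1), φ.f t.castSucc ≤ p.castSucc ∧ p.castSucc < φ.f t.succ := by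
  by_contra hcon
  push Not at hcon
  have : ∀ t : Fin (m + 2), φ.f t ≤ p.castSucc := by
    intro t
    induction t using Fin.induction with
    | zero => rw [φ.zero]; exact Fin.zero_le _
    | succ t ih => exact hcon t ih
  have h := this (Fin.last _)
  rw [φ.last, Fin.le_def] at h
  have := p.isLt
  simp at h
  omega

theorem block_sum {m M : ℕ} (φ : Grid m M) (F : Fin (M + 2) → ℝ) (w : Fin (m + 1) → ℝ)
    (β : Fin (M + 1) → Fin (m + 1))
    (hβ : ∀ p, φ.f (β p).castSucc ≤ p.castSucc ∧ p.castSucc < φ.f (β p).succ) :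
    ∑ p : Fin (M + 1), w (β p) * (F p.succ - F p.castSucc) =
    ∑ t : Fin (m + 1), w t * (F (φ.f t.succ) - F (φ.f t.castSucc)) := by
  rw [← Finset.sum_fiberwise (s := Finset.univ) (g := β)]
  refine Finset.sum_congr rfl fun t _ => ?_
  have huniq : ∀ p, β p = t ↔ (φ.f t.castSucc ≤ p.castSucc ∧ p.castSucc < φ.f t.succ) := by
    intro p
    constructor
    · rintro rfl; exact hβ p
    · rintro ⟨h1, h2⟩
      obtain ⟨h3, h4⟩ := hβ p
      have h5 := φ.mono.lt_iff_lt.1 (lt_of_le_of_lt h1 h4)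
      have h6 := φ.mono.lt_iff_lt.1 (lt_of_le_of_lt h3 h2)
      rw [Fin.lt_def] at h5 h6
      simp at h5 h6
      ext; omega
  have hs : ∑ p ∈ Finset.univ.filter (fun p => β p = t), w (β p) * (F p.succ - F p.castSucc)
      = w t * ∑ p ∈ Finset.univ.filter (fun p => β p = t), (F p.succ - F p.castSucc) := by
    rw [Finset.mul_sum]
    refine Finset.sum_congr rfl fun p hp => ?_
    rw [(Finset.mem_filter.1 hp).2]
  rw [hs]
  congr 1
  let F' : ℕ → ℝ := fun x => if h : x < M + 2 then F ⟨x, h⟩ else 0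
  have hF : ∀ x : Fin (M + 2), F x = F' x := by
    intro x; simp [F']
  have hle : (φ.f t.castSucc : ℕ) ≤ φ.f t.succ := by
    have := φ.mono (show t.castSucc < t.succ by rw [Fin.lt_def]; simp)
    exact le_of_lt this
  rw [hF (φ.f t.succ), hF (φ.f t.castSucc), ← Finset.sum_Ico_sub F' hle]
  refine Finset.sum_bij (fun p _ => (p : ℕ)) ?_ ?_ ?_ ?_
  · intro p hp
    have := (huniq p).1 (Finset.mem_filter.1 hp).2
    rw [Fin.le_def, Fin.lt_def] at this
    simpa using this
  · intro p _ q _ h; exact Fin.ext h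
  · intro x hx
    rw [Finset.mem_Ico] at hx
    have := (φ.f t.succ).isLt
    refine ⟨⟨x, by omega⟩, ?_, rfl⟩
    rw [Finset.mem_filter, huniq, Fin.le_def, Fin.lt_def]
    simpa using hx
  · intro p _
    rw [hF, hF]; simp

theorem refine_tree {n m : ℕ} (T : BCTree n m) : ∀ (_ : ¬ T.hasCut) (M : ℕ) (φ : Grid m M),
    ∃ C : BCTree n M, ¬ C.hasCut ∧
      ∀ (G : Goal n) (f : Fin (M + 2) → ℝ), Valid f → (win G C f ↔ win G T (f ∘ φ.f)) := by
  induction T with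
  | @leaf m alloc =>
    intro _ M φ
    choose β hβ using exists_block φ
    refine ⟨.leaf (fun p => alloc (β p)), by simp [BCTree.hasCut], fun G f hf => ?_⟩
    have key : ∀ a, pieceValue G.V (allocOf ((List.finRange (M + 1)).map
        fun t => (f t.castSucc, f t.succ, alloc (β t))) a) =
        pieceValue G.V (allocOf ((List.finRange (m + 1)).map
        fun t => ((f ∘ φ.f) t.castSucc, (f ∘ φ.f) t.succ, alloc t)) a) := by
      intro a
      rw [pieceValue_alloc, pieceValue_alloc]
      have := block_sum φ (fun x => G.V.v 0 (f x)) (fun t => if alloc t = a then 1 else 0) β hβ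
      simp only [ite_mul, one_mul, zero_mul] at this
      have hg := hf.grid φ
      rw [Finset.sum_congr rfl (fun t _ => by
        rw [v_eq G.V (hf.nonneg _) (hf.le _) (hf.le_one _)])]
      rw [this]
      refine Finset.sum_congr rfl (fun t _ => ?_)
      rw [v_eq G.V (hg.nonneg _) (hg.le _) (hg.le_one _)]
      rfl
    simp only [win, Goal.ok, envy, key]
  | cut a j child ih => intro h; simp [BCTree.hasCut] at h
  | choose a children ih =>
    intro h M φ
    simp only [BCTree.hasCut, not_exists] at h
    choose C hC1 hC2 using fun t => ih t (h t) M φ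
    refine ⟨.choose a C, by simpa [BCTree.hasCut] using hC1, fun G f hf => ?_⟩
    simp only [win, fun t => hC2 t G f hf]

/-! ### Realizable problems -/

/-- A position-dependent winning condition. -/
abbrev Prob (n m : ℕ) := Goal n → (Fin (m + 2) → ℝ) → Prop

def Rz {n m : ℕ} (X : Prob n m) : Prop :=
  ∃ B : BCTree n m, B.cutsBeforeChoices ∧ ∀ G f, Valid f → (win G B f ↔ X G f)

def pull {n m M : ℕ} (X : Prob n m) (φ : Grid m M) : Prob n M := fun G f => X G (f ∘ φ.f)

def HR {n m : ℕ} (X : Prob n m) : Prop := ∀ M (φ : Grid m M), Rz (pull X φ)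

def op {n m : ℕ} (a : Fin n) (X Y : Prob n m) : Prob n m := fun G f =>
  if a = G.i then X G f ∨ Y G f else X G f ∧ Y G f

theorem HR.pull {n m M : ℕ} {X : Prob n m} (h : HR X) (φ : Grid m M) : HR (pull X φ) :=
  fun N ψ => h N (φ.comp ψ)

theorem HR.rz {n m : ℕ} {X : Prob n m} (h : HR X) : Rz X := h m (Grid.id m)

theorem Rz.congr {n m : ℕ} {X Y : Prob n m} (h : Rz X)
    (e : ∀ G f, Valid f → (X G f ↔ Y G f)) : Rz Y := by
  obtain ⟨B, h1, h2⟩ := h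
  exact ⟨B, h1, fun G f hf => (h2 G f hf).trans (e G f hf)⟩

theorem HR.congr {n m : ℕ} {X Y : Prob n m} (h : HR X)
    (e : ∀ G f, Valid f → (X G f ↔ Y G f)) : HR Y :=
  fun M φ => (h M φ).congr fun G _ hf => e G _ (hf.grid φ)

/-- The problem where agent `b` cuts piece `p` and then `X` is played. -/
def cutProb {n m : ℕ} (b : Fin n) (p : Fin (m + 1)) (X : Prob n (m + 1)) : Prob n m :=
  fun G f => if b = G.i then ∃ y, f p.castSucc ≤ y ∧ y ≤ f p.succ ∧ X G (insertPt f p y)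
      else ∀ y, f p.castSucc ≤ y → y ≤ f p.succ → X G (insertPt f p y)

theorem Rz.cut {n m : ℕ} (b : Fin n) (p : Fin (m + 1)) {X : Prob n (m + 1)} (h : Rz X) :
    Rz (cutProb b p X) := by
  obtain ⟨B, h1, h2⟩ := h
  refine ⟨.cut b p B, h1, fun G f hf => ?_⟩
  simp only [win, cutProb]
  split_ifs
  · exact exists_congr fun y => and_congr_right fun h3 => and_congr_right fun h4 =>
      h2 G _ (hf.insertPt p h3 h4)
  · exact forall_congr' fun y => forall_congr' fun h3 => forall_congr' fun h4 =>
      h2 G _ (hf.insertPt p h3 h4)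

theorem cutProb_congr {n m : ℕ} (b : Fin n) (p : Fin (m + 1)) {X Y : Prob n (m + 1)}
    (G : Goal n) (f : Fin (m + 2) → ℝ)
    (h : ∀ y, f p.castSucc ≤ y → y ≤ f p.succ →
      (X G (insertPt f p y) ↔ Y G (insertPt f p y))) :
    cutProb b p X G f ↔ cutProb b p Y G f := by
  simp only [cutProb]
  split_ifs
  · exact exists_congr fun y => and_congr_right fun h3 => and_congr_right fun h4 => h y h3 h4
  · exact forall_congr' fun y => forall_congr' fun h3 => forall_congr' fun h4 => h y h3 h4

theorem cutProb_op_left {n m : ℕ} (a b : Fin n) (p : Fin (m + 1)) (X : Prob n (m + 1))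
    (Y : Prob n m) (G : Goal n) (f : Fin (m + 2) → ℝ) (hf : Valid f) :
    cutProb b p (op a X (pull Y (skip p))) G f ↔ op a (cutProb b p X) Y G f := by
  have h1 := hf.le p
  simp only [cutProb, op, pull, insertPt_skip]
  by_cases hb : b = G.i <;> by_cases ha : a = G.i <;> simp only [hb, ha, if_true, if_false]
  · constructor
    · rintro ⟨y, h2, h3, h4 | h4⟩
      · exact Or.inl ⟨y, h2, h3, h4⟩
      · exact Or.inr h4
    · rintro (⟨y, h2, h3, h4⟩ | h4)
      · exact ⟨y, h2, h3, Or.inl h4⟩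
      · exact ⟨_, le_rfl, h1, Or.inr h4⟩
  · constructor
    · rintro ⟨y, h2, h3, h4, h5⟩; exact ⟨⟨y, h2, h3, h4⟩, h5⟩
    · rintro ⟨⟨y, h2, h3, h4⟩, h5⟩; exact ⟨y, h2, h3, h4, h5⟩
  · constructor
    · intro h
      by_cases hY : Y G f
      · exact Or.inr hY
      · exact Or.inl fun y h2 h3 => (h y h2 h3).resolve_right hY
    · rintro (h | h) y h2 h3
      · exact Or.inl (h y h2 h3)
      · exact Or.inr h
  · constructor
    · intro h
      exact ⟨fun y h2 h3 => (h y h2 h3).1, (h _ le_rfl h1).2⟩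
    · rintro ⟨h, h'⟩ y h2 h3; exact ⟨h y h2 h3, h'⟩

theorem op_comm {n m : ℕ} (a : Fin n) (X Y : Prob n m) (G f) :
    op a X Y G f ↔ op a Y X G f := by
  simp only [op]; split_ifs
  · exact or_comm
  · exact and_comm

theorem op_congr {n m : ℕ} (a : Fin n) {X Y X' Y' : Prob n m} {G f}
    (h1 : X G f ↔ X' G f) (h2 : Y G f ↔ Y' G f) :
    op a X Y G f ↔ op a X' Y' G f := by
  simp only [op, h1, h2]

theorem cbc_of_not_hasCut {n m : ℕ} (C : BCTree n m) (h : ¬ C.hasCut) :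
    C.cutsBeforeChoices := by
  cases C with
  | leaf => trivial
  | cut => simp [BCTree.hasCut] at h
  | choose => simpa [BCTree.hasCut, BCTree.cutsBeforeChoices] using h

theorem rz_two {n m : ℕ} (a : Fin n) (C D : BCTree n m) (hC : ¬ C.hasCut) (hD : ¬ D.hasCut) :
    Rz (op a (fun G f => win G C f) (fun G f => win G D f)) := by
  refine ⟨.choose a (k := 1) ![C, D], ?_, fun G f _ => ?_⟩
  · intro t; fin_cases t
    · exact hC
    · exact hD
  · simp only [win, op]
    split_ifs
    · exact Fin.exists_fin_two
    · exact Fin.forall_fin_two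

theorem rz_lemmaA {n m : ℕ} (a : Fin n) (D : BCTree n m) : ∀ (_ : D.cutsBeforeChoices)
    (C : BCTree n m) (_ : ¬ C.hasCut),
    Rz (op a (fun G f => win G D f) (fun G f => win G C f)) := by
  induction D with
  | leaf alloc => intro _ C hC; exact rz_two a _ _ (by simp [BCTree.hasCut]) hC
  | choose i ch ih => intro h C hC; exact rz_two a _ _ (by simpa [BCTree.hasCut, BCTree.cutsBeforeChoices] using h) hC
  | cut b j child ih =>
    intro h C hC
    obtain ⟨C', h1, h2⟩ := refine_tree C hC _ (skip j)
    refine ((ih h C' h1).cut b j).congr fun G f hf => ?_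
    refine Iff.trans ?_
      (cutProb_op_left a b j (fun G f => win G child f) (fun G f => win G C f) G f hf)
    apply cutProb_congr
    intro y h3 h4
    exact op_congr a Iff.rfl (h2 G _ (hf.insertPt j h3 h4))

theorem rz_lemmaB {n m : ℕ} (a : Fin n) (D : BCTree n m) : ∀ (_ : D.cutsBeforeChoices)
    (Y : Prob n m) (_ : HR Y), Rz (op a (fun G f => win G D f) Y) := by
  have base : ∀ {m} (D : BCTree n m), ¬ D.hasCut → ∀ (Y : Prob n m), HR Y →
      Rz (op a (fun G f => win G D f) Y) := by
    intro m D hD Y hY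
    obtain ⟨B, h1, h2⟩ := hY.rz
    exact (rz_lemmaA a B h1 D hD).congr fun G f hf =>
      (op_comm _ _ _ _ _).trans (op_congr a Iff.rfl (h2 G f hf))
  induction D with
  | leaf alloc => intro _ Y hY; exact base _ (by simp [BCTree.hasCut]) Y hY
  | choose i ch ih => intro h Y hY; exact base _ (by simpa [BCTree.hasCut, BCTree.cutsBeforeChoices] using h) Y hY
  | cut b j child ih =>
    intro h Y hY
    refine ((ih h _ (hY.pull (skip j))).cut b j).congr fun G f hf => ?_
    exact cutProb_op_left a b j (fun G f => win G child f) Y G f hf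

theorem HR.op {n m : ℕ} (a : Fin n) {X Y : Prob n m} (hX : HR X) (hY : HR Y) :
    HR (op a X Y) := by
  intro M φ
  obtain ⟨B, h1, h2⟩ := hX M φ
  exact (rz_lemmaB a B h1 _ (hY.pull φ)).congr fun G f hf =>
    op_congr (X' := BCProof.pull X φ) (Y' := BCProof.pull Y φ) a (h2 G f hf) Iff.rfl

def chProb {n m k : ℕ} (a : Fin n) (X : Fin (k + 1) → Prob n m) : Prob n m := fun G f =>
  if a = G.i then ∃ t, X t G f else ∀ t, X t G f

theorem HR.ch {n m : ℕ} (a : Fin n) : ∀ {k : ℕ} {X : Fin (k + 1) → Prob n m},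
    (∀ t, HR (X t)) → HR (chProb a X) := by
  intro k
  induction k with
  | zero =>
    intro X h
    refine (h 0).congr fun G f _ => ?_
    simp [chProb]
  | succ k ih =>
    intro X h
    refine ((h 0).op a (ih fun t => h t.succ)).congr fun G f _ => ?_
    simp only [chProb, BCProof.op]
    split_ifs
    · exact (Fin.exists_fin_succ (P := fun t => X t G f)).symm
    · exact (Fin.forall_fin_succ (P := fun t => X t G f)).symm

/-- Agent `b` cuts in one of the fine pieces `p, …, p + k - 1`. -/
def segProb {n m M : ℕ} (b : Fin n) (j : Fin (m + 1)) (X : Prob n (m + 1)) (φ : Grid m M)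
    (p k : ℕ) : Prob n M := fun G f =>
  if b = G.i then ∃ q : Fin (M + 1), p ≤ q ∧ (q : ℕ) < p + k ∧
      ∃ y, f q.castSucc ≤ y ∧ y ≤ f q.succ ∧ X G (insertPt (f ∘ φ.f) j y)
  else ∀ q : Fin (M + 1), p ≤ q → (q : ℕ) < p + k →
      ∀ y, f q.castSucc ≤ y → y ≤ f q.succ → X G (insertPt (f ∘ φ.f) j y)

theorem segProb_succ {n m M : ℕ} (b : Fin n) (j : Fin (m + 1)) (X : Prob n (m + 1))
    (φ : Grid m M) (p : Fin (M + 1)) (k : ℕ) (h1) (h2) (G : Goal n) (f : Fin (M + 2) → ℝ) :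
    segProb b j X φ p (k + 1) G f ↔
      op b (cutProb b p (pull X (ins φ j p h1 h2))) (segProb b j X φ (p + 1) k) G f := by
  simp only [segProb, op, cutProb, pull, insertPt_ins]
  split_ifs
  · constructor
    · rintro ⟨q, h3, h4, h5⟩
      by_cases h : q = p
      · subst h; exact Or.inl h5
      · have : (q : ℕ) ≠ p := fun h' => h (Fin.ext h')
        exact Or.inr ⟨q, by omega, by omega, h5⟩
    · rintro (h | ⟨q, h3, h4, h5⟩)
      · exact ⟨p, le_rfl, by omega, h⟩
      · exact ⟨q, by omega, by omega, h5⟩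
  · constructor
    · intro h
      exact ⟨h p le_rfl (by omega), fun q h3 h4 => h q (by omega) (by omega)⟩
    · rintro ⟨h, h'⟩ q h3 h4
      by_cases hq : q = p
      · subst hq; exact h
      · have : (q : ℕ) ≠ p := fun h' => hq (Fin.ext h')
        exact h' q (by omega) (by omega)

theorem segProb_skip {n m M : ℕ} (b : Fin n) (j : Fin (m + 1)) (X : Prob n (m + 1))
    (φ : Grid m M) (p : Fin (M + 1)) (k : ℕ) (G : Goal n) (f : Fin (M + 2) → ℝ) (y : ℝ) :
    segProb b j X (φ.comp (skip p)) (p + 2) k G (insertPt f p y) ↔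
      segProb b j X φ (p + 1) k G f := by
  have e : insertPt f p y ∘ (φ.comp (skip p)).f = f ∘ φ.f := by
    conv_rhs => rw [← insertPt_skip f p y]
    rfl
  have e1 : ∀ q : Fin (M + 1), (p : ℕ) + 1 ≤ q →
      insertPt f p y q.succ.castSucc = f q.castSucc := fun q hq =>
    insertPt_gt _ _ _ _ _ (by simp; omega) (by simp)
  have e2 : ∀ q : Fin (M + 1), (p : ℕ) + 1 ≤ q →
      insertPt f p y q.succ.succ = f q.succ := fun q hq =>
    insertPt_gt _ _ _ _ _ (by simp; omega) (by simp)
  simp only [segProb, e]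
  split_ifs
  · rw [Fin.exists_fin_succ]
    constructor
    · rintro (⟨h, _⟩ | ⟨q, h3, h4, h5⟩)
      · simp at h
      · rw [Fin.val_succ] at h3 h4
        rw [e1 q (by omega), e2 q (by omega)] at h5
        exact ⟨q, by omega, by omega, h5⟩
    · rintro ⟨q, h3, h4, h5⟩
      refine Or.inr ⟨q, by rw [Fin.val_succ]; omega, by rw [Fin.val_succ]; omega, ?_⟩
      rw [e1 q (by omega), e2 q (by omega)]
      exact h5
  · rw [Fin.forall_fin_succ]
    constructor
    · rintro ⟨_, h⟩ q h3 h4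
      have := h q (by rw [Fin.val_succ]; omega) (by rw [Fin.val_succ]; omega)
      rw [e1 q (by omega), e2 q (by omega)] at this
      exact this
    · intro h
      refine ⟨fun h' => by simp at h', fun q h3 h4 => ?_⟩
      rw [Fin.val_succ] at h3 h4
      rw [e1 q (by omega), e2 q (by omega)]
      exact h q (by omega) (by omega)

theorem or_shuffle (P Q R : Prop) : (P ∨ Q) ∨ R ↔ Q ∨ (P ∨ R) := by tauto

theorem and_shuffle (P Q R : Prop) : (P ∧ Q) ∧ R ↔ Q ∧ (P ∧ R) := by tauto

theorem rz_seg {n m : ℕ} (b : Fin n) (j : Fin (m + 1)) (X : Prob n (m + 1)) (hX : HR X) :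
    ∀ (k : ℕ) {M : ℕ} (φ : Grid m M) (p : ℕ) (Y : Prob n M),
    (φ.f j.castSucc : ℕ) ≤ p → p + k ≤ φ.f j.succ →
    (k = 0 → Rz Y) →
    (∀ {M'} (ψ : Grid M M') (Z : Prob n M'), HR Z → HR (op b (pull Y ψ) Z)) →
    Rz (op b Y (segProb b j X φ p k)) := by
  intro k
  induction k with
  | zero =>
    intro M φ p Y _ _ h3 _
    refine (h3 rfl).congr fun G f _ => ?_
    simp only [op, segProb]
    split_ifs
    · constructor
      · exact Or.inl
      · rintro (h | ⟨q, h5, h6, _⟩)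
        · exact h
        · omega
    · constructor
      · exact fun h => ⟨h, fun q h5 h6 => by omega⟩
      · exact fun h => h.1
  | succ k ih =>
    intro M φ p0 Y h1 h2 _ hop
    have hlt := (φ.f j.succ).isLt
    obtain ⟨p, rfl⟩ : ∃ p : Fin (M + 1), (p : ℕ) = p0 := ⟨⟨p0, by omega⟩, rfl⟩
    have g1 : φ.f j.castSucc ≤ p.castSucc := by rw [Fin.le_def]; simpa using h1
    have g2 : p.castSucc < φ.f j.succ := by rw [Fin.lt_def]; simp; omega
    have hY' := hop (skip p) _ (hX.pull (ins φ j p g1 g2))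
    have := ih (φ.comp (skip p)) (p + 2) _ (by
        simp only [Grid.comp, skip]
        split_ifs <;> simp <;> omega) (by
        simp only [Grid.comp, skip]
        split_ifs <;> simp <;> omega) (fun _ => hY'.rz)
      (fun ψ Z hZ => (hY'.pull ψ).op b hZ)
    refine (this.cut b p).congr fun G f hf => ?_
    have s1 : cutProb b p (op b (op b (pull Y (skip p)) (pull X (ins φ j p g1 g2)))
        (segProb b j X (φ.comp (skip p)) (↑p + 2) k)) G f ↔
        cutProb b p (op b (op b (pull X (ins φ j p g1 g2)) (pull Y (skip p)))
        (pull (segProb b j X φ (↑p + 1) k) (skip p))) G f := by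
      apply cutProb_congr
      intro y _ _
      apply op_congr
      · exact op_comm _ _ _ _ _
      · rw [segProb_skip]
        simp only [pull, insertPt_skip]
    rw [s1, cutProb_op_left _ _ _ _ _ _ _ hf]
    have s2 := cutProb_op_left b b p (pull X (ins φ j p g1 g2)) Y G f hf
    have s3 := segProb_succ b j X φ p k g1 g2 G f
    simp only [op] at s2 s3 ⊢
    rw [s2, s3]
    split_ifs
    · exact or_shuffle _ _ _
    · exact and_shuffle _ _ _

theorem HR.cut {n m : ℕ} (b : Fin n) (j : Fin (m + 1)) {X : Prob n (m + 1)} (hX : HR X) :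
    HR (cutProb b j X) := by
  intro M φ
  have hlt : (φ.f j.castSucc : ℕ) < φ.f j.succ :=
    φ.mono (show j.castSucc < j.succ by rw [Fin.lt_def]; simp)
  have hlt2 := (φ.f j.succ).isLt
  have := rz_seg b j X hX (φ.f j.succ - φ.f j.castSucc) φ (φ.f j.castSucc)
    (fun G _ => ¬ b = G.i) le_rfl (by omega) (by omega) (fun ψ Z hZ => hZ.congr (by
      intro G f _
      simp only [BCProof.op, BCProof.pull]
      split_ifs with h <;> simp [h]))
  refine this.congr fun G f hf => ?_
  have cover : ∀ y, f (φ.f j.castSucc) ≤ y → y ≤ f (φ.f j.succ) →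
      ∃ q : Fin (M + 1), (φ.f j.castSucc : ℕ) ≤ q ∧ (q : ℕ) < φ.f j.succ ∧
        f q.castSucc ≤ y ∧ y ≤ f q.succ := by
    intro y hy1 hy2
    by_contra hcon
    push Not at hcon
    have : ∀ t : Fin (M + 2), φ.f j.castSucc ≤ t → t ≤ φ.f j.succ → f t ≤ y ∧
        (t ≠ φ.f j.castSucc → f t < y) := by
      intro t
      induction t using Fin.induction with
      | zero =>
        intro h1 _
        have : φ.f j.castSucc = 0 := le_antisymm h1 (Fin.zero_le _)
        rw [← this]
        exact ⟨hy1, fun h => absurd rfl h⟩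
      | succ t ih =>
        intro h1 h2
        rcases h1.eq_or_lt with h | h
        · rw [← h]; exact ⟨hy1, fun h => absurd rfl h⟩
        · rw [Fin.lt_def] at h
          rw [Fin.le_def] at h2
          simp only [Fin.val_succ] at h h2
          have h3 := ih (by rw [Fin.le_def]; simp; omega) (by rw [Fin.le_def]; simp; omega)
          have h4 := hcon t (by omega) (by omega) h3.1
          exact ⟨h4.le, fun _ => h4⟩
    have h5 := (this (φ.f j.succ) (le_of_lt hlt) le_rfl).2 (ne_of_gt hlt)
    linarith
  have hb : ∀ q : Fin (M + 1), (φ.f j.castSucc : ℕ) ≤ q → (q : ℕ) < φ.f j.succ →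
      f (φ.f j.castSucc) ≤ f q.castSucc ∧ f q.succ ≤ f (φ.f j.succ) := fun q h1 h2 =>
    ⟨hf.1 (by rw [Fin.le_def]; simpa using h1), hf.1 (by rw [Fin.le_def]; simp; omega)⟩
  have hsum : (φ.f j.castSucc : ℕ) + (φ.f j.succ - φ.f j.castSucc) = φ.f j.succ := by omega
  simp only [BCProof.op, segProb, BCProof.pull, cutProb, hsum]
  by_cases h : b = G.i
  · simp only [h, if_true, not_true, false_or]
    constructor
    · rintro ⟨q, h1, h2, y, h3, h4, h5⟩
      exact ⟨y, (hb q h1 h2).1.trans h3, h4.trans (hb q h1 h2).2, h5⟩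
    · rintro ⟨y, h3, h4, h5⟩
      obtain ⟨q, h1, h2, h6, h7⟩ := cover y h3 h4
      exact ⟨q, h1, h2, y, h6, h7, h5⟩
  · simp only [h, if_false, not_false_eq_true, true_and]
    constructor
    · intro h' y h3 h4
      obtain ⟨q, h1, h2, h6, h7⟩ := cover y h3 h4
      exact h' q h1 h2 y h6 h7
    · intro h' q h1 h2 y h3 h4
      exact h' y ((hb q h1 h2).1.trans h3) (h4.trans (hb q h1 h2).2)

theorem HR.tree {n m : ℕ} (T : BCTree n m) : HR (fun G f => win G T f) := by
  induction T with
  | leaf alloc =>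
    intro M φ
    obtain ⟨C, h1, h2⟩ := refine_tree (.leaf alloc : BCTree n _) (by simp [BCTree.hasCut]) M φ
    exact ⟨C, cbc_of_not_hasCut C h1, h2⟩
  | cut a j child ih => exact HR.cut a j ih
  | choose a children ih => exact HR.ch a ih

theorem valid_init : Valid (m := 0) initPts := by
  refine ⟨?_, ?_, ?_⟩
  · intro s t h
    fin_cases s <;> fin_cases t <;> simp [initPts] at h ⊢
  · simp [initPts]
  · simp [initPts]

end BCProof

/-- **Theorem.** Any BC protocol can be converted into a strongly envy-equivalent BC
protocol in which no choose node of the tree representation has a cut node among its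
descendants (so along every root-to-leaf path all cut nodes precede all choose
nodes). -/
theorem bc_cuts_before_choices {n : ℕ} (B : BCTree n 0) :
    ∃ B' : BCTree n 0, B'.cutsBeforeChoices ∧ StronglyEnvyEquiv B.toGame B'.toGame := by
  obtain ⟨B', h1, h2⟩ := (BCProof.HR.tree B).rz
  refine ⟨B', h1, fun i S _ M _ V => ?_⟩
  have e1 := BCProof.guar_iff ⟨i, S, M, V⟩ B initPts [] BCProof.valid_init
  have e2 := BCProof.guar_iff ⟨i, S, M, V⟩ B' initPts [] BCProof.valid_init
  exact e1.trans ((h2 ⟨i, S, M, V⟩ initPts BCProof.valid_init).symm.trans e2.symm)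
end
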